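/- arXiv:1708.05338 — 8 statements merged into one kernel-verified Lean document; each statement's English description precedes it below -/
import Mathlib

section
/- Let n ∈ ℕ₊ and let 𝔞 ⊆ ℂ[X₁, …, Xₙ] be an ideal. Then for every i > 0 we have dim_ℂ(F^𝔞ᵢ / F^𝔞ᵢ₋₁) ≤ (n/i) · dim_ℂ(F^𝔞ᵢ₋₁). -/
open MvPolynomial Module

/-- `F^𝔞_i`: the subspace of `ℂ[X₁,…,Xₙ]/𝔞` of elements representable as `f + 𝔞` with
`deg f ≤ i`. -/
noncomputable def Fdeg (n : ℕ) (𝔞 : Ideal (MvPolynomial (Fin n) ℂ)) (i : ℕ) :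
    Submodule ℂ (MvPolynomial (Fin n) ℂ ⧸ 𝔞) :=
  (restrictTotalDegree (Fin n) ℂ i).map (Ideal.Quotient.mkₐ ℂ 𝔞).toLinearMap

/-- standard exponents: not the leading exponent of a nonzero element of the ideal -/
def IsStd {n : ℕ} (𝔞 : Ideal (MvPolynomial (Fin n) ℂ)) (m : Fin n →₀ ℕ) : Prop :=
  ∀ f ∈ 𝔞, f ≠ 0 → (MonomialOrder.degLex).degree f ≠ m

lemma IsStd.mono {n : ℕ} {𝔞 : Ideal (MvPolynomial (Fin n) ℂ)} {m m' : Fin n →₀ ℕ}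
    (h : IsStd 𝔞 m) (hm : m' ≤ m) : IsStd 𝔞 m' := by
  intro f hf hf0 hd
  have h1 : (monomial (m - m') (1 : ℂ)) ≠ 0 := by simp
  refine h (monomial (m - m') 1 * f) (𝔞.mul_mem_left _ hf) (mul_ne_zero h1 hf0) ?_
  rw [MonomialOrder.degree_mul h1 hf0, hd]
  classical
  rw [MonomialOrder.degree_monomial]
  simp [tsub_add_cancel_of_le hm]

lemma finite_std {n : ℕ} (𝔞 : Ideal (MvPolynomial (Fin n) ℂ)) (i : ℕ) :
    {m : Fin n →₀ ℕ | IsStd 𝔞 m ∧ m.degree ≤ i}.Finite :=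
  (Finsupp.finite_of_degree_le i).subset (fun _ h => h.2)

/-- finset of standard exponents of degree at most `i` -/
noncomputable def stdF {n : ℕ} (𝔞 : Ideal (MvPolynomial (Fin n) ℂ)) (i : ℕ) :
    Finset (Fin n →₀ ℕ) := (finite_std 𝔞 i).toFinset

lemma mem_stdF {n : ℕ} {𝔞 : Ideal (MvPolynomial (Fin n) ℂ)} {i : ℕ} {m : Fin n →₀ ℕ} :
    m ∈ stdF 𝔞 i ↔ IsStd 𝔞 m ∧ m.degree ≤ i := by
  simp [stdF]

lemma std_linInd {n : ℕ} (𝔞 : Ideal (MvPolynomial (Fin n) ℂ)) (i : ℕ) :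
    LinearIndependent ℂ (fun m : stdF 𝔞 i =>
      (Ideal.Quotient.mkₐ ℂ 𝔞).toLinearMap (monomial (m : Fin n →₀ ℕ) (1 : ℂ))) := by
  rw [Fintype.linearIndependent_iff]
  intro g hg
  set p : MvPolynomial (Fin n) ℂ := ∑ m : stdF 𝔞 i, g m • monomial (m : Fin n →₀ ℕ) (1 : ℂ) with hp
  have hp𝔞 : p ∈ 𝔞 := by
    rw [← Ideal.Quotient.eq_zero_iff_mem]
    have : (Ideal.Quotient.mkₐ ℂ 𝔞).toLinearMap p = 0 := by
      rw [hp, map_sum, ← hg]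
      simp only [map_smul]
    exact this
  have hc : ∀ d, p.coeff d = ∑ m : stdF 𝔞 i, if (m : Fin n →₀ ℕ) = d then g m else 0 := by
    intro d
    simp [hp, coeff_sum, coeff_monomial]
  have hp0 : p = 0 := by
    by_contra h0
    have h1 := (MonomialOrder.coeff_degree_ne_zero_iff (m := MonomialOrder.degLex)).2 h0
    rw [hc] at h1
    obtain ⟨m, _, hm⟩ := Finset.exists_ne_zero_of_sum_ne_zero h1
    have hm' : (m : Fin n →₀ ℕ) = MonomialOrder.degLex.degree p := by
      by_contra h; simp [h] at hm
    exact (mem_stdF.1 m.2).1 p hp𝔞 h0 hm'.symm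
  intro m
  have := hc m
  rw [hp0] at this
  simp only [coeff_zero, Subtype.coe_inj, Finset.sum_ite_eq', Finset.mem_univ, if_true] at this
  exact this.symm

lemma mono_mem_span {n : ℕ} (𝔞 : Ideal (MvPolynomial (Fin n) ℂ)) (i : ℕ) (m : Fin n →₀ ℕ)
    (hi : m.degree ≤ i) : (Ideal.Quotient.mkₐ ℂ 𝔞).toLinearMap (monomial m (1 : ℂ)) ∈
      Submodule.span ℂ (Set.range (fun m : stdF 𝔞 i =>
      (Ideal.Quotient.mkₐ ℂ 𝔞).toLinearMap (monomial (m : Fin n →₀ ℕ) (1 : ℂ)))) := by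
  have key : ∀ s : DegLex (Fin n →₀ ℕ), (ofDegLex s).degree ≤ i →
    (Ideal.Quotient.mkₐ ℂ 𝔞).toLinearMap (monomial (ofDegLex s) (1 : ℂ)) ∈
      Submodule.span ℂ (Set.range (fun m : stdF 𝔞 i =>
      (Ideal.Quotient.mkₐ ℂ 𝔞).toLinearMap (monomial (m : Fin n →₀ ℕ) (1 : ℂ)))) := by
    intro s
    induction s using WellFoundedLT.induction with
    | ind s ih =>
    intro hs
    by_cases hS : IsStd 𝔞 (ofDegLex s)
    · exact Submodule.subset_span ⟨⟨ofDegLex s, mem_stdF.2 ⟨hS, hs⟩⟩, rfl⟩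
    · unfold IsStd at hS
      push Not at hS
      obtain ⟨f, hf, hf0, hd⟩ := hS
      have hc0 : f.coeff (ofDegLex s) ≠ 0 := by
        rw [← hd]; exact (MonomialOrder.coeff_degree_ne_zero_iff).2 hf0
      set c := f.coeff (ofDegLex s) with hc
      set q := monomial (ofDegLex s) (1 : ℂ) - c⁻¹ • f with hq
      have e : (Ideal.Quotient.mkₐ ℂ 𝔞).toLinearMap (monomial (ofDegLex s) (1 : ℂ)) =
          (Ideal.Quotient.mkₐ ℂ 𝔞).toLinearMap q := by
        have : (Ideal.Quotient.mkₐ ℂ 𝔞).toLinearMap f = 0 :=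
          Ideal.Quotient.eq_zero_iff_mem.2 hf
        rw [hq, map_sub, map_smul, this]; simp
      rw [e, q.as_sum, map_sum]
      refine Submodule.sum_mem _ fun d hdq => ?_
      have e2 : monomial d (q.coeff d) = q.coeff d • monomial d (1 : ℂ) := by
        rw [smul_monomial]; simp
      rw [e2, map_smul]
      refine Submodule.smul_mem _ _ ?_
      rw [MvPolynomial.mem_support_iff] at hdq
      have hne : ofDegLex s ≠ d := by
        rintro rfl
        apply hdq
        simp [hq, ← hc, hc0]
      have hdf : d ∈ f.support := by
        rw [MvPolynomial.mem_support_iff]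
        intro h
        apply hdq
        simp [hq, coeff_monomial, hne, h]
      have hle : toDegLex d ≤ s := by
        have := MonomialOrder.le_degree (m := MonomialOrder.degLex) hdf
        rw [hd] at this
        exact this
      have hlt : toDegLex d < s := lt_of_le_of_ne hle (fun h => hne (by rw [← h]; rfl))
      exact ih _ hlt ((Finsupp.DegLex.monotone_degree hle).trans hs)
  exact key (toDegLex m) hi

lemma finrank_Fdeg {n : ℕ} (𝔞 : Ideal (MvPolynomial (Fin n) ℂ)) (i : ℕ) :
    finrank ℂ (Fdeg n 𝔞 i) = (stdF 𝔞 i).card := by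
  have : Fdeg n 𝔞 i = Submodule.span ℂ (Set.range (fun m : stdF 𝔞 i =>
      (Ideal.Quotient.mkₐ ℂ 𝔞).toLinearMap (monomial (m : Fin n →₀ ℕ) (1 : ℂ)))) := by
    apply le_antisymm
    · rintro _ ⟨p, hp, rfl⟩
      rw [SetLike.mem_coe, mem_restrictTotalDegree] at hp
      rw [p.as_sum, map_sum]
      refine Submodule.sum_mem _ fun d hd => ?_
      have e2 : monomial d (p.coeff d) = p.coeff d • monomial d (1 : ℂ) := by
        rw [smul_monomial]; simp
      rw [e2, map_smul]
      refine Submodule.smul_mem _ _ (mono_mem_span 𝔞 i d ?_)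
      exact (le_totalDegree hd).trans hp
    · rw [Submodule.span_le]
      rintro _ ⟨m, rfl⟩
      refine ⟨_, ?_, rfl⟩
      rw [SetLike.mem_coe, mem_restrictTotalDegree]
      rw [totalDegree_monomial _ one_ne_zero]
      exact (mem_stdF.1 m.2).2
  rw [this, finrank_span_eq_card (std_linInd 𝔞 i), Fintype.card_coe]

lemma degree_erase_add {n : ℕ} (m : Fin n →₀ ℕ) (k : Fin n) :
    (m.erase k).degree + m k = m.degree := by
  conv_rhs => rw [← Finsupp.erase_add_single k m]
  simp

lemma count {n : ℕ} (𝔞 : Ideal (MvPolynomial (Fin n) ℂ)) (i : ℕ) (hi : 0 < i) :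
    i * ((stdF 𝔞 i).filter (fun m => m.degree = i)).card ≤ (stdF 𝔞 (i - 1)).card * n := by
  classical
  set A := (stdF 𝔞 i).filter (fun m => m.degree = i) with hA
  have h1 : (A.sigma (fun m => (Finset.univ : Finset (Fin n)).sigma
      (fun k => Finset.range (m k)))).card = i * A.card := by
    rw [Finset.card_sigma, mul_comm, ← smul_eq_mul, ← Finset.sum_const]
    refine Finset.sum_congr rfl fun m hm => ?_
    rw [Finset.card_sigma]
    simp only [Finset.card_range]
    rw [← Finsupp.degree_eq_sum]
    exact (Finset.mem_filter.1 hm).2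
  have h2 : (stdF 𝔞 (i - 1) ×ˢ (Finset.univ : Finset (Fin n))).card =
    (stdF 𝔞 (i - 1)).card * n := by simp
  rw [← h1, ← h2]
  refine Finset.card_le_card_of_injOn
    (fun x => (x.1.erase x.2.1 + Finsupp.single x.2.1 x.2.2, x.2.1)) ?_ ?_
  · rintro ⟨m, k, j⟩ hx
    simp only [Finset.coe_sigma, Set.mem_sigma_iff, Finset.mem_coe, Finset.mem_range] at hx
    obtain ⟨hm, -, hj⟩ := hx
    obtain ⟨hm, hd⟩ := Finset.mem_filter.1 hm
    simp only [Finset.coe_product, Set.mem_prod, Finset.mem_coe, Finset.mem_univ, and_true]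
    refine mem_stdF.2 ⟨(mem_stdF.1 hm).1.mono ?_, ?_⟩
    · conv_rhs => rw [← Finsupp.erase_add_single k m]
      gcongr
    · have := degree_erase_add m k
      simp only [map_add, Finsupp.degree_single]
      omega
  · rintro ⟨m, k, j⟩ hx ⟨m', k', j'⟩ hx' h
    simp only [Finset.coe_sigma, Set.mem_sigma_iff, Finset.mem_coe] at hx hx'
    have hd := (Finset.mem_filter.1 hx.1).2
    have hd' := (Finset.mem_filter.1 hx'.1).2
    simp only [Prod.mk.injEq] at h
    obtain ⟨h, rfl⟩ := h
    have hj : j = j' := by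
      have := DFunLike.congr_fun h k
      simpa using this
    subst hj
    have he := add_right_cancel h
    have hk : m k = m' k := by
      have e1 := degree_erase_add m k
      have e2 := degree_erase_add m' k
      rw [he] at e1
      omega
    have : m = m' := by
      rw [← Finsupp.erase_add_single k m, he, hk, Finsupp.erase_add_single]
    subst this
    rfl

lemma card_split {n : ℕ} (𝔞 : Ideal (MvPolynomial (Fin n) ℂ)) (i : ℕ) (hi : 0 < i) :
    (stdF 𝔞 i).card = ((stdF 𝔞 i).filter (fun m => m.degree = i)).card
      + (stdF 𝔞 (i - 1)).card := by
  rw [← Finset.card_filter_add_card_filter_not (s := stdF 𝔞 i) (fun m => m.degree = i)]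
  congr 2
  ext m
  simp only [Finset.mem_filter, mem_stdF, and_assoc]
  refine and_congr_right fun _ => ?_
  omega

/-- **Corollary (of Macaulay's theorem).** For an ideal `𝔞 ⊆ ℂ[X₁,…,Xₙ]` and every `i > 0`,
`dim(F^𝔞ᵢ / F^𝔞ᵢ₋₁) ≤ (n/i) · dim F^𝔞ᵢ₋₁`. -/
theorem macaulay_quotient_filtration
    (n : ℕ) (hn : 0 < n) (𝔞 : Ideal (MvPolynomial (Fin n) ℂ)) :
    ∀ i : ℕ, 0 < i →
      (finrank ℂ (Fdeg n 𝔞 i) : ℝ) - finrank ℂ (Fdeg n 𝔞 (i - 1)) ≤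
        ((n : ℝ) / i) * finrank ℂ (Fdeg n 𝔞 (i - 1)) := by
  intro i hi
  rw [finrank_Fdeg, finrank_Fdeg, card_split 𝔞 i hi]
  have h := count 𝔞 i hi
  have h' : (i : ℝ) * ((stdF 𝔞 i).filter (fun m => m.degree = i)).card
      ≤ (stdF 𝔞 (i - 1)).card * n := by exact_mod_cast h
  have hi' : (0 : ℝ) < i := by exact_mod_cast hi
  push_cast
  rw [add_sub_cancel_right, div_mul_eq_mul_div, le_div_iff₀ hi']
  linarith
end

section
/- Let n ∈ ℕ₊, let 𝔞 ⊆ ℂ[X₁, …, Xₙ] be an ideal, and let R ≥ 1. Then dim_ℂ(F^𝔞_{2R}) ≤ eⁿ · dim_ℂ(F^𝔞_R), where e is Euler's number. -/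
open MvPolynomial Module

/-- Standard monomials of an ideal with respect to degLex. -/
def stdMon (n : ℕ) (𝔞 : Ideal (MvPolynomial (Fin n) ℂ)) : Set (Fin n →₀ ℕ) :=
  {m | ∀ f ∈ 𝔞, f ≠ 0 → MonomialOrder.degLex.degree f ≠ m}

/-- Class of a monomial. -/
noncomputable def vMon (n : ℕ) (𝔞 : Ideal (MvPolynomial (Fin n) ℂ)) (m : Fin n →₀ ℕ) :
    MvPolynomial (Fin n) ℂ ⧸ 𝔞 :=
  (Ideal.Quotient.mkₐ ℂ 𝔞).toLinearMap (monomial m 1)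

open Classical in
/-- Standard monomials of degree at most `d`. -/
noncomputable def stdFin (n : ℕ) (𝔞 : Ideal (MvPolynomial (Fin n) ℂ)) (d : ℕ) :
    Finset (Fin n →₀ ℕ) :=
  (Finsupp.finite_of_degree_le (σ := Fin n) d).toFinset.filter (· ∈ stdMon n 𝔞)

theorem mem_stdFin {n : ℕ} {𝔞 : Ideal (MvPolynomial (Fin n) ℂ)} {d : ℕ} {m : Fin n →₀ ℕ} :
    m ∈ stdFin n 𝔞 d ↔ m.degree ≤ d ∧ m ∈ stdMon n 𝔞 := by
  simp [stdFin]

theorem stdMon_down {n : ℕ} {𝔞 : Ideal (MvPolynomial (Fin n) ℂ)} {a b : Fin n →₀ ℕ}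
    (hab : a ≤ b) (hb : b ∈ stdMon n 𝔞) : a ∈ stdMon n 𝔞 := by
  intro f hf hf0 ha
  have h1 : (monomial (b - a) (1 : ℂ)) ≠ 0 := by simp
  refine hb (monomial (b - a) 1 * f) (𝔞.mul_mem_left _ hf) (mul_ne_zero h1 hf0) ?_
  rw [MonomialOrder.degree_mul h1 hf0, ha, MonomialOrder.degree_monomial, if_neg one_ne_zero]
  exact tsub_add_cancel_of_le hab

theorem map_eq_sum {n : ℕ} (𝔞 : Ideal (MvPolynomial (Fin n) ℂ)) (f : MvPolynomial (Fin n) ℂ) :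
    (Ideal.Quotient.mkₐ ℂ 𝔞).toLinearMap f = ∑ k ∈ f.support, f.coeff k • vMon n 𝔞 k := by
  conv_lhs => rw [f.as_sum]
  rw [map_sum]
  refine Finset.sum_congr rfl fun k _ => ?_
  rw [vMon, ← map_smul, smul_monomial, smul_eq_mul, mul_one]

theorem vMon_mem_span {n : ℕ} (𝔞 : Ideal (MvPolynomial (Fin n) ℂ)) (d : ℕ) (s : MonomialOrder.degLex.syn) :
    ∀ m : Fin n →₀ ℕ, MonomialOrder.degLex.toSyn m = s → m.degree ≤ d →
      vMon n 𝔞 m ∈ Submodule.span ℂ (vMon n 𝔞 '' (stdFin n 𝔞 d : Set (Fin n →₀ ℕ))) := by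
  induction s using WellFoundedLT.induction with
  | ind s ih =>
  intro m hm hd
  by_cases hS : m ∈ stdMon n 𝔞
  · exact Submodule.subset_span ⟨m, mem_stdFin.2 ⟨hd, hS⟩, rfl⟩
  · simp only [stdMon, Set.mem_ofPred_eq, not_forall, not_not] at hS
    obtain ⟨f, hf, hf0, hfm⟩ := hS
    have hsum := map_eq_sum 𝔞 f
    have h0 : (Ideal.Quotient.mkₐ ℂ 𝔞).toLinearMap f = 0 := by
      simpa using Ideal.Quotient.eq_zero_iff_mem.2 hf
    have hmem : m ∈ f.support := hfm ▸ MonomialOrder.degLex.degree_mem_support hf0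
    rw [h0, ← Finset.add_sum_erase _ _ hmem] at hsum
    have hc : f.coeff m ≠ 0 := mem_support_iff.1 hmem
    rw [← Submodule.smul_mem_iff _ hc, eq_neg_of_add_eq_zero_left hsum.symm]
    refine Submodule.neg_mem _ (Submodule.sum_mem _ fun k hk => Submodule.smul_mem _ _ ?_)
    rw [Finset.mem_erase] at hk
    have hle := MonomialOrder.degLex.le_degree hk.2
    rw [hfm] at hle
    refine ih _ ?_ k rfl (le_trans (Finsupp.DegLex.monotone_degree hle) hd)
    rw [← hm]
    exact lt_of_le_of_ne hle (fun h => hk.1 (MonomialOrder.degLex.toSyn.injective h))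

theorem Fdeg_le_span {n : ℕ} (𝔞 : Ideal (MvPolynomial (Fin n) ℂ)) (d : ℕ) :
    Fdeg n 𝔞 d ≤ Submodule.span ℂ (vMon n 𝔞 '' (stdFin n 𝔞 d : Set (Fin n →₀ ℕ))) := by
  rintro _ ⟨f, hf, rfl⟩
  rw [map_eq_sum]
  refine Submodule.sum_mem _ fun k hk => Submodule.smul_mem _ _ ?_
  refine vMon_mem_span 𝔞 d _ k rfl ?_
  exact le_trans (le_totalDegree hk) ((mem_restrictTotalDegree _ _ _).1 hf)

theorem finrank_le_card {n : ℕ} (𝔞 : Ideal (MvPolynomial (Fin n) ℂ)) (d : ℕ) :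
    finrank ℂ (Fdeg n 𝔞 d) ≤ (stdFin n 𝔞 d).card := by
  classical
  have hfd := Fdeg_le_span 𝔞 d
  rw [← Finset.coe_image] at hfd
  exact (Submodule.finrank_mono hfd).trans
    ((finrank_span_finset_le_card _).trans Finset.card_image_le)

theorem card_le_finrank {n : ℕ} (𝔞 : Ideal (MvPolynomial (Fin n) ℂ)) (d : ℕ) :
    (stdFin n 𝔞 d).card ≤ finrank ℂ (Fdeg n 𝔞 d) := by
  classical
  have hfd := Fdeg_le_span 𝔞 d
  rw [← Finset.coe_image] at hfd
  haveI : Module.Finite ℂ (Fdeg n 𝔞 d) := Submodule.finiteDimensional_of_le hfd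
  have hmem : ∀ m : stdFin n 𝔞 d, vMon n 𝔞 m ∈ Fdeg n 𝔞 d := fun m => by
    refine ⟨_, (mem_restrictTotalDegree _ _ _).2 ?_, rfl⟩
    exact (totalDegree_monomial_le _ _).trans (mem_stdFin.1 m.2).1
  have hli : LinearIndependent ℂ (fun m : stdFin n 𝔞 d => (⟨vMon n 𝔞 m, hmem m⟩ : Fdeg n 𝔞 d)) := by
    apply LinearIndependent.of_comp (Fdeg n 𝔞 d).subtype
    rw [Fintype.linearIndependent_iff]
    intro g hg
    set f : MvPolynomial (Fin n) ℂ := ∑ m : stdFin n 𝔞 d, monomial m.1 (g m) with hf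
    have hcoeff : ∀ k, f.coeff k = ∑ m : stdFin n 𝔞 d, if m.1 = k then g m else 0 := by
      intro k
      simp [hf, coeff_sum, coeff_monomial]
    have hfa : f ∈ 𝔞 := by
      rw [← Ideal.Quotient.eq_zero_iff_mem]
      change (Ideal.Quotient.mkₐ ℂ 𝔞).toLinearMap f = 0
      rw [← hg, hf, map_sum]
      refine Finset.sum_congr rfl fun m _ => ?_
      simp only [Function.comp, Submodule.subtype_apply, vMon]
      rw [← map_smul, smul_monomial, smul_eq_mul, mul_one]
    have hf0 : f = 0 := by
      by_contra h
      have h1 := mem_support_iff.1 (MonomialOrder.degLex.degree_mem_support h)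
      rw [hcoeff] at h1
      obtain ⟨m, -, hm⟩ := Finset.exists_ne_zero_of_sum_ne_zero h1
      have hm' : m.1 = MonomialOrder.degLex.degree f := by
        by_contra hne
        exact hm (if_neg hne)
      exact (mem_stdFin.1 m.2).2 f hfa h hm'.symm
    intro m
    have := hcoeff m
    rw [hf0, coeff_zero] at this
    simpa [Subtype.coe_inj] using this.symm
  simpa using hli.fintype_card_le_finrank

theorem card_doubling {n : ℕ} (𝔞 : Ideal (MvPolynomial (Fin n) ℂ)) (R : ℕ) :
    (stdFin n 𝔞 (2 * R)).card ≤ 2 ^ n * (stdFin n 𝔞 R).card := by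
  classical
  let φ : (Fin n →₀ ℕ) → (Fin n → Bool) × (Fin n →₀ ℕ) := fun m =>
    (fun i => decide (m i % 2 = 1), Finsupp.equivFunOnFinite.symm fun i => m i / 2)
  have h : (stdFin n 𝔞 (2 * R)).card ≤
      ((Finset.univ : Finset (Fin n → Bool)) ×ˢ stdFin n 𝔞 R).card := by
    apply Finset.card_le_card_of_injOn φ
    · intro m hm
      obtain ⟨h1, h2⟩ := mem_stdFin.1 hm
      simp only [Finset.coe_product, Set.mem_prod, Finset.coe_univ, Set.mem_univ, true_and]
      refine mem_stdFin.2 ⟨?_, stdMon_down (fun i => ?_) h2⟩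
      · rw [Finsupp.degree_eq_sum] at h1 ⊢
        have : 2 * ∑ i, m i / 2 ≤ ∑ i, m i := by
          rw [Finset.mul_sum]
          exact Finset.sum_le_sum fun i _ => Nat.mul_div_le _ _
        simp only [φ, Finsupp.equivFunOnFinite_symm_apply_apply]
        omega
      · exact Nat.div_le_self _ _
    · intro a _ b _ hab
      simp only [φ, Prod.mk.injEq, EmbeddingLike.apply_eq_iff_eq] at hab
      ext i
      have h1 := congrFun hab.1 i
      have h2 := congrFun hab.2 i
      simp only [decide_eq_decide] at h1
      omega
  simpa [Finset.card_product] using h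

/-- For an ideal `𝔞 ⊆ ℂ[X₁,…,Xₙ]` and `R ≥ 1` we have
`dim F^𝔞_{2R} ≤ eⁿ · dim F^𝔞_R`, where `e` is Euler's number. -/
theorem doubling_dimension_bound
    (n : ℕ) (hn : 0 < n) (𝔞 : Ideal (MvPolynomial (Fin n) ℂ)) (R : ℕ) (hR : 1 ≤ R) :
    (finrank ℂ (Fdeg n 𝔞 (2 * R)) : ℝ) ≤
      Real.exp n * finrank ℂ (Fdeg n 𝔞 R) := by
  have h : finrank ℂ (Fdeg n 𝔞 (2 * R)) ≤ 2 ^ n * finrank ℂ (Fdeg n 𝔞 R) :=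
    (finrank_le_card 𝔞 _).trans ((card_doubling 𝔞 R).trans
      (Nat.mul_le_mul_left _ (card_le_finrank 𝔞 R)))
  have h' : (finrank ℂ (Fdeg n 𝔞 (2 * R)) : ℝ) ≤ 2 ^ n * finrank ℂ (Fdeg n 𝔞 R) := by
    exact_mod_cast h
  refine h'.trans (mul_le_mul_of_nonneg_right ?_ (Nat.cast_nonneg _))
  rw [← Real.exp_one_pow]
  have := Real.add_one_le_exp 1
  exact pow_le_pow_left₀ (by norm_num) (by linarith) n
end

section
/- Let n ∈ ℕ₊, let 𝔞 ⊆ ℂ[X₁, …, Xₙ] be an ideal and let V ⊆ ℂ[X₁, …, Xₙ] be a finite-dimensional ℂ-linear subspace with V ∩ rad(𝔞) = {0}. Then there exists a surjective ℂ-algebra homomorphism σ : ℂ[X₁, …, Xₙ] → ℂ^{dim V} (where ℂ^{dim V} carries pointwise multiplication) which is injective on V and such that 𝔞 ⊆ ker(σ). -/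
open MvPolynomial Module

/-- **Proposition (consequence of Hilbert's Nullstellensatz).** Let `𝔞 ⊆ ℂ[X₁,…,Xₙ]` be an
ideal and `V` a finite-dimensional linear subspace with `V ∩ rad(𝔞) = {0}`. Then there is a
surjective `ℂ`-algebra homomorphism `σ : ℂ[X₁,…,Xₙ] → ℂ^{dim V}` (pointwise operations on the
target) which is injective on `V` and with `𝔞 ⊆ ker σ`. -/
theorem algebra_hom_injective_on_subspace
    (n : ℕ) (hn : 0 < n)
    (𝔞 : Ideal (MvPolynomial (Fin n) ℂ))
    (V : Submodule ℂ (MvPolynomial (Fin n) ℂ))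
    (hV : FiniteDimensional ℂ V)
    (hV𝔞 : ∀ f ∈ V, f ∈ 𝔞.radical → f = 0) :
    ∃ σ : MvPolynomial (Fin n) ℂ →ₐ[ℂ] (Fin (finrank ℂ V) → ℂ),
      Function.Surjective σ ∧
      Set.InjOn σ (V : Set (MvPolynomial (Fin n) ℂ)) ∧
      𝔞 ≤ RingHom.ker σ.toRingHom := by
  classical
  let e : (Fin n → ℂ) → Dual ℂ V := fun x =>
    (aeval x : MvPolynomial (Fin n) ℂ →ₐ[ℂ] ℂ).toLinearMap.comp V.subtype
  let S : Set (Dual ℂ V) := e '' (zeroLocus ℂ 𝔞)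
  have hsep : ∀ v : V, (∀ x ∈ zeroLocus ℂ 𝔞, e x v = 0) → v = 0 := by
    intro v h
    apply Subtype.ext
    apply hV𝔞 _ v.2
    rw [← vanishingIdeal_zeroLocus_eq_radical (K := ℂ)]
    exact h
  have hspan : Submodule.span ℂ S = ⊤ := by
    have hb : (Submodule.span ℂ S).dualCoannihilator = ⊥ := by
      rw [eq_bot_iff]
      intro v hv
      rw [Submodule.mem_dualCoannihilator] at hv
      exact hsep v fun x hx => hv _ (Submodule.subset_span ⟨x, hx, rfl⟩)
    rw [← Subspace.dualCoannihilator_dualAnnihilator_eq (W := Submodule.span ℂ S), hb,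
      Submodule.dualAnnihilator_bot]
  have hr : finrank ℂ (Submodule.span ℂ S) = finrank ℂ V := by
    rw [hspan, finrank_top, Subspace.dual_finrank_eq]
  have hg := Submodule.exists_fun_fin_finrank_span_eq ℂ S
  rw [hr] at hg
  obtain ⟨g, hgS, hgspan, -⟩ := hg
  choose x hx hxe using hgS
  let σ : MvPolynomial (Fin n) ℂ →ₐ[ℂ] (Fin (finrank ℂ V) → ℂ) :=
    Pi.algHom ℂ _ fun i => aeval (x i)
  have hinj : Function.Injective (σ.toLinearMap.comp V.subtype) := by
    rw [← LinearMap.ker_eq_bot, eq_bot_iff]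
    intro v hv
    have hg0 : ∀ i, g i v = 0 := by
      intro i
      rw [← hxe i]
      exact congrFun (LinearMap.mem_ker.1 hv) i
    apply hsep v
    intro y hy
    have hm : e y ∈ Submodule.span ℂ (Set.range g) := by
      rw [hgspan]; exact Submodule.subset_span ⟨y, hy, rfl⟩
    have hle : Submodule.span ℂ (Set.range g) ≤ LinearMap.ker (Dual.eval ℂ V v) := by
      rw [Submodule.span_le]
      rintro _ ⟨i, rfl⟩
      exact hg0 i
    exact hle hm
  refine ⟨σ, ?_, ?_, ?_⟩
  · have hs := (LinearMap.injective_iff_surjective_of_finrank_eq_finrank (by simp)).1 hinj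
    intro y
    obtain ⟨v, hv⟩ := hs y
    exact ⟨v, hv⟩
  · intro a ha b hb hab
    exact congrArg Subtype.val (@hinj ⟨a, ha⟩ ⟨b, hb⟩ hab)
  · intro p hp
    rw [RingHom.mem_ker]
    funext i
    exact hx i p hp
end

section
/- Let n ∈ ℕ₊, let 𝔞 ⊆ ℂ[X₁, …, Xₙ] be an ideal and let R ∈ ℕ be such that F^𝔞_R ∩ (rad(𝔞)/𝔞) = {0 + 𝔞}. Then there exist simultaneously diagonalisable linear maps M₁, …, Mₙ : F^𝔞_R → F^𝔞_R such that for every v ∈ F^𝔞_{R−1} and every i = 1, …, n we have Mᵢ(v) = μ^𝔞ᵢ(v). -/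
open MvPolynomial Module

/-- `μ^𝔞ᵢ`: multiplication by `Xᵢ + 𝔞` on `ℂ[X₁,…,Xₙ]/𝔞`, as a `ℂ`-linear endomorphism. -/
noncomputable def muX (n : ℕ) (𝔞 : Ideal (MvPolynomial (Fin n) ℂ)) (i : Fin n) :
    Module.End ℂ (MvPolynomial (Fin n) ℂ ⧸ 𝔞) :=
  LinearMap.mulLeft ℂ (Ideal.Quotient.mk 𝔞 (X i))

/-- A separating family of functionals contains a dual basis. -/
theorem exists_basis_of_separating {V : Type*} [AddCommGroup V] [Module ℂ V]
    [FiniteDimensional ℂ V] {ι : Type*} (e : ι → Dual ℂ V)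
    (he : ∀ v, (∀ i, e i v = 0) → v = 0) :
    ∃ (b : Basis (Fin (finrank ℂ V)) ℂ V) (p : Fin (finrank ℂ V) → ι),
      ∀ k v, b.repr v k = e (p k) v := by
  have hs : (⊤ : Submodule ℂ (Dual ℂ V)) ≤ Submodule.span ℂ (Set.range e) := by
    rw [← Subspace.dualCoannihilator_dualAnnihilator_eq (W := Submodule.span ℂ (Set.range e))]
    have : (Submodule.span ℂ (Set.range e)).dualCoannihilator = ⊥ := by
      rw [eq_bot_iff]
      intro v hv
      rw [Submodule.mem_dualCoannihilator] at hv
      exact he v fun i => hv _ (Submodule.subset_span ⟨i, rfl⟩)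
    rw [this]
    simp
  let B0 := Basis.ofSpan hs
  have hfin : finrank ℂ (Dual ℂ V) = finrank ℂ V := Subspace.dual_finrank_eq
  haveI := FiniteDimensional.fintypeBasisIndex B0
  let B := B0.reindex (Fintype.equivFinOfCardEq ((finrank_eq_card_basis B0).symm.trans hfin))
  have hB : ∀ k, ∃ i, e i = B k := by
    intro k
    have : B k ∈ Set.range B0 := by simp [B]
    exact Basis.ofSpan_subset hs this
  choose p hp using hB
  let Φ : V →ₗ[ℂ] (Fin (finrank ℂ V) → ℂ) := LinearMap.pi fun k => e (p k)
  have hinj : Function.Injective Φ := by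
    rw [injective_iff_map_eq_zero]
    intro v hv
    have hv' : ∀ k, B k v = 0 := fun k => by
      rw [← hp]; exact congrFun hv k
    have h0 : Dual.eval ℂ V v = 0 := B.ext fun k => by simpa using hv' k
    exact he v fun i => by simpa using LinearMap.congr_fun h0 (e i)
  let E := LinearEquiv.ofInjectiveOfFinrankEq Φ hinj (by simp)
  refine ⟨Basis.ofEquivFun E, p, fun k v => ?_⟩
  rw [Basis.ofEquivFun_repr_apply]
  rfl

/-- **Corollary.** If `𝔞 ⊆ ℂ[X₁,…,Xₙ]` is an ideal and `R ∈ ℕ` is such that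
`F^𝔞_R ∩ (rad(𝔞)/𝔞) = {0}`, then there exist simultaneously diagonalisable linear maps
`M₁, …, Mₙ : F^𝔞_R → F^𝔞_R` which agree with the multiplication maps `μ^𝔞ᵢ` on `F^𝔞_{R−1}`
(for `R = 0` the latter condition is vacuous, `F^𝔞_{−1}` being the zero space). -/
theorem multiplication_maps_diagonalisable
    (n : ℕ) (hn : 0 < n) (𝔞 : Ideal (MvPolynomial (Fin n) ℂ)) (R : ℕ)
    (hrad : ∀ x ∈ Fdeg n 𝔞 R, x ∈ Ideal.map (Ideal.Quotient.mk 𝔞) 𝔞.radical → x = 0) :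
    ∃ M : Fin n → (Fdeg n 𝔞 R →ₗ[ℂ] Fdeg n 𝔞 R),
      (∃ b : Basis (Fin (finrank ℂ (Fdeg n 𝔞 R))) ℂ (Fdeg n 𝔞 R),
        ∀ (j : Fin (finrank ℂ (Fdeg n 𝔞 R))) (i : Fin n), ∃ c : ℂ, M i (b j) = c • b j) ∧
      ∀ (j : ℕ), j + 1 = R →
        ∀ (v : MvPolynomial (Fin n) ℂ ⧸ 𝔞) (hv : v ∈ Fdeg n 𝔞 j) (hv' : v ∈ Fdeg n 𝔞 R)
          (i : Fin n),
          ((M i ⟨v, hv'⟩ : Fdeg n 𝔞 R) : MvPolynomial (Fin n) ℂ ⧸ 𝔞) = muX n 𝔞 i v := by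
  have hFR : FiniteDimensional ℂ (Fdeg n 𝔞 R) := by
    unfold Fdeg; infer_instance
  let ev : (zeroLocus ℂ 𝔞) → ((MvPolynomial (Fin n) ℂ ⧸ 𝔞) →ₐ[ℂ] ℂ) := fun x =>
    Ideal.Quotient.liftₐ 𝔞 (aeval x.1) (fun p hp => x.2 p hp)
  have hev : ∀ x p, ev x (Ideal.Quotient.mk 𝔞 p) = aeval x.1 p := fun x p => rfl
  have hsep : ∀ v ∈ Fdeg n 𝔞 R, (∀ x, ev x v = 0) → v = 0 := by
    intro v hv h
    refine hrad v hv ?_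
    obtain ⟨f, rfl⟩ := Ideal.Quotient.mk_surjective v
    apply Ideal.mem_map_of_mem
    rw [← vanishingIdeal_zeroLocus_eq_radical (K := ℂ)]
    intro x hx
    exact h ⟨x, hx⟩
  obtain ⟨b, p, hb⟩ := exists_basis_of_separating
    (fun x => (ev x).toLinearMap ∘ₗ (Fdeg n 𝔞 R).subtype)
    (fun v hv => Subtype.ext (hsep v v.2 hv))
  have hM : ∀ i j, b.constr ℂ (fun j => (p j).1 i • b j) (b j) = (p j).1 i • b j :=
    fun i j => b.constr_basis ℂ _ j
  refine ⟨fun i => b.constr ℂ (fun j => (p j).1 i • b j), ⟨b, fun j i => ⟨_, hM i j⟩⟩, ?_⟩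
  rintro j rfl v hv hv' i
  have hmem : muX n 𝔞 i v ∈ Fdeg n 𝔞 (j + 1) := by
    obtain ⟨f, hf, rfl⟩ := hv
    refine ⟨X i * f, ?_, rfl⟩
    rw [SetLike.mem_coe, mem_restrictTotalDegree] at hf ⊢
    refine (totalDegree_mul _ _).trans ?_
    rw [totalDegree_X]
    omega
  suffices h : b.constr ℂ (fun j => (p j).1 i • b j) ⟨v, hv'⟩ = ⟨muX n 𝔞 i v, hmem⟩ from
    congrArg Subtype.val h
  apply b.repr.injective
  ext k
  have h1 : ∀ w, b.repr (b.constr ℂ (fun j => (p j).1 i • b j) w) k = (p k).1 i * b.repr w k := by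
    intro w
    have : b.coord k ∘ₗ b.constr ℂ (fun j => (p j).1 i • b j) = (p k).1 i • b.coord k := by
      refine b.ext fun l => ?_
      rw [LinearMap.comp_apply, hM]
      by_cases hl : l = k
      · subst hl; simp
      · simp [Finsupp.single_apply, hl]
    exact LinearMap.congr_fun this w
  rw [h1, hb, hb]
  change _ * ev (p k) v = ev (p k) (Ideal.Quotient.mk 𝔞 (X i) * v)
  rw [map_mul, hev, aeval_X]
end

section
/- Fix n ∈ ℕ₊. For every ε > 0 there exist R ∈ ℕ and δ > 0 such that the following holds. Suppose d ∈ ℕ₊, let ℳ = (M₁, …, Mₙ) be a tuple of d×d complex matrices, and let W ⊆ ℂ^d be an R-multi-ballspace for ℳ with dim(W) ≥ (1−δ)·d. Then there exists a simultaneously diagonalisable tuple 𝒜 = (A₁, …, Aₙ) of d×d complex matrices such that d_rank(ℳ, 𝒜) ≤ 2ε. -/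
open MvPolynomial Module Matrix

variable {V : Type*} [AddCommGroup V] [Module ℂ V]

/-- For a tuple `M : Fin n → End(V)` and a word `α : [q] → [n]`, the composite
`ℳ_α = M_{α 0} ∘ ⋯ ∘ M_{α (q-1)}` (the empty word gives the identity). -/
noncomputable def mword {n : ℕ} (M : Fin n → Module.End ℂ V) {q : ℕ}
    (α : Fin q → Fin n) : Module.End ℂ V :=
  (List.ofFn fun j => M (α j)).prod

/-- The `R`-ballspace `B_ℳ(w, R)`: the span of all `ℳ_α(w)` over words `α` of length `≤ R`. -/
noncomputable def ballSpace {n : ℕ} (M : Fin n → Module.End ℂ V) (w : V) (R : ℕ) :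
    Submodule ℂ V :=
  Submodule.span ℂ {v | ∃ (q : ℕ) (_ : q ≤ R) (α : Fin q → Fin n), v = mword M α w}

/-- The ballspace `B_ℳ(w, R)` is regular: there are an ideal `𝔞 ⊆ ℂ[X₁,…,Xₙ]` and a linear
isomorphism `φ : B_ℳ(w, R) ≃ F^𝔞_R` intertwining `Mᵢ` on `B_ℳ(w, R−1)` with `μ^𝔞ᵢ`
(for `R = 0` the ball `B_ℳ(w, −1)` is read as the zero space), and such that
`F^𝔞_R ∩ (rad(𝔞)/𝔞) = {0}`. -/
noncomputable def IsRegularBall {n : ℕ} (M : Fin n → Module.End ℂ V) (w : V) (R : ℕ) : Prop :=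
  ∃ (𝔞 : Ideal (MvPolynomial (Fin n) ℂ))
    (φ : (ballSpace M w R) ≃ₗ[ℂ] (Fdeg n 𝔞 R)),
    (∀ (j : ℕ), j + 1 = R → ∀ (i : Fin n) (v : V),
      v ∈ ballSpace M w j → ∀ (hv' : v ∈ ballSpace M w R) (hvi : M i v ∈ ballSpace M w R),
        ((φ ⟨M i v, hvi⟩ : Fdeg n 𝔞 R) : MvPolynomial (Fin n) ℂ ⧸ 𝔞) =
          muX n 𝔞 i ((φ ⟨v, hv'⟩ : Fdeg n 𝔞 R) : MvPolynomial (Fin n) ℂ ⧸ 𝔞)) ∧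
    (∀ x : MvPolynomial (Fin n) ℂ ⧸ 𝔞, x ∈ Fdeg n 𝔞 R →
      x ∈ Ideal.map (Ideal.Quotient.mk 𝔞) 𝔞.radical → x = 0)

/-- `W` is an `R`-multi-ballspace for `ℳ`: a direct sum of regular ballspaces
`B_ℳ(wⱼ, Rⱼ)` with roots `wⱼ ∈ W` and radii `Rⱼ ≥ R`. -/
noncomputable def IsMultiBall {n : ℕ} (M : Fin n → Module.End ℂ V) (R : ℕ)
    (W : Submodule ℂ V) : Prop :=
  ∃ (k : ℕ) (w : Fin k → V) (Rad : Fin k → ℕ),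
    (∀ j, R ≤ Rad j) ∧ (∀ j, w j ∈ W) ∧
    (∀ j, IsRegularBall M (w j) (Rad j)) ∧
    (W = ⨆ j, ballSpace M (w j) (Rad j)) ∧
    iSupIndep (fun j => ballSpace M (w j) (Rad j))


section helpers

lemma fr_mem_ball {n : ℕ} (M : Fin n → Module.End ℂ V) (w : V) {R : ℕ} (l : List (Fin n))
    (h : l.length ≤ R) : (l.map M).prod w ∈ ballSpace M w R := by
  refine Submodule.subset_span ⟨l.length, h, l.get, ?_⟩
  unfold mword
  congr 2
  conv_lhs => rw [← List.ofFn_get l]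
  rw [List.map_ofFn]
  rfl

lemma fr_ball_eq {n : ℕ} (M : Fin n → Module.End ℂ V) (w : V) (R : ℕ) :
    ballSpace M w R =
      Submodule.span ℂ {v | ∃ l : List (Fin n), l.length ≤ R ∧ v = (l.map M).prod w} := by
  apply le_antisymm
  · refine Submodule.span_mono ?_
    rintro v ⟨q, hq, α, rfl⟩
    refine ⟨List.ofFn α, by simpa using hq, ?_⟩
    unfold mword
    rw [List.map_ofFn]
    rfl
  · rw [Submodule.span_le]
    rintro v ⟨l, hl, rfl⟩
    exact fr_mem_ball M w l hl

lemma fr_ball_mono {n : ℕ} (M : Fin n → Module.End ℂ V) (w : V) {R S : ℕ} (h : R ≤ S) :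
    ballSpace M w R ≤ ballSpace M w S := by
  refine Submodule.span_mono ?_
  rintro v ⟨q, hq, α, rfl⟩
  exact ⟨q, hq.trans h, α, rfl⟩

lemma fr_ball_step {n : ℕ} (M : Fin n → Module.End ℂ V) (w : V) {j : ℕ} (i : Fin n) {v : V}
    (hv : v ∈ ballSpace M w j) : M i v ∈ ballSpace M w (j + 1) := by
  rw [fr_ball_eq] at hv
  induction hv using Submodule.span_induction with
  | mem x hx =>
    obtain ⟨l, hl, rfl⟩ := hx
    have := fr_mem_ball M w (R := j + 1) (i :: l) (by simpa using hl)
    simpa using this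
  | zero => simp
  | add x y _ _ hx hy => rw [map_add]; exact Submodule.add_mem _ hx hy
  | smul a x _ hx => rw [map_smul]; exact Submodule.smul_mem _ _ hx

lemma fr_ball_pow {n : ℕ} (M : Fin n → Module.End ℂ V) (w : V) {j : ℕ} (i : Fin n) (k : ℕ) {v : V}
    (hv : v ∈ ballSpace M w j) : (M i ^ k) v ∈ ballSpace M w (j + k) := by
  induction k with
  | zero => simpa using hv
  | succ k ih =>
    rw [pow_succ', Module.End.mul_apply]
    exact fr_ball_step M w i ih

/-- words act commutatively on the root of a regular ball -/
lemma fr_perm {n : ℕ} (M : Fin n → Module.End ℂ V) (w : V) (R : ℕ) (h : IsRegularBall M w R)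
    (l l' : List (Fin n)) (hp : l.Perm l') (hl : l.length ≤ R) :
    (l.map M).prod w = (l'.map M).prod w := by
  obtain ⟨𝔞, φ, h1, -⟩ := h
  have key : ∀ (l : List (Fin n)) (hl : l.length ≤ R),
      ((φ ⟨(l.map M).prod w, fr_mem_ball M w l hl⟩ : Fdeg n 𝔞 R) : MvPolynomial (Fin n) ℂ ⧸ 𝔞) =
        Ideal.Quotient.mk 𝔞 ((l.map X).prod) *
          ((φ ⟨w, by simpa using fr_mem_ball M w (R := R) [] (by simp)⟩ : Fdeg n 𝔞 R) :
            MvPolynomial (Fin n) ℂ ⧸ 𝔞) := by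
    intro l
    induction l with
    | nil => intro _; simp
    | cons i l ih =>
      intro hl
      have hl' : l.length + 1 ≤ R := by simpa using hl
      have e := h1 (R - 1) (by omega) i ((l.map M).prod w)
        (fr_mem_ball M w l (by omega)) (fr_mem_ball M w l (by omega))
        (by simpa using fr_mem_ball M w (i :: l) hl)
      have e2 := ih (by omega)
      rw [e2] at e
      simp only [List.map_cons, List.prod_cons, Module.End.mul_apply]
      rw [e]
      simp only [muX, LinearMap.mulLeft_apply, map_mul]
      ring
  have e1 := key l hl
  have e2 := key l' (by rw [← hp.length_eq]; exact hl)
  rw [(hp.map X).prod_eq, ← e2] at e1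
  have := φ.injective (Subtype.ext e1)
  simpa using this

lemma fr_pigeon {n : ℕ} (hn : 0 < n) (l : List (Fin n)) (k : ℕ) (h : k * n ≤ l.length) :
    ∃ i, k ≤ l.count i := by
  by_contra! hc
  have hs : ∑ i : Fin n, l.count i = l.length := by
    have := Multiset.sum_count_eq_card (s := Finset.univ) (m := (l : Multiset (Fin n))) (by simp)
    simpa using this
  have : ∑ i : Fin n, l.count i < ∑ _i : Fin n, k :=
    Finset.sum_lt_sum_of_nonempty ⟨⟨0, hn⟩, Finset.mem_univ _⟩ (fun i _ => hc i)
  simp at this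
  nlinarith

lemma fr_cover {n : ℕ} (hn : 0 < n) (M : Fin n → Module.End ℂ V) (w : V) (R : ℕ)
    (h : IsRegularBall M w (R + 1)) (k : ℕ) (hk : k * n ≤ R + 1) (hk' : k ≤ R) :
    ballSpace M w (R + 1) ≤ ballSpace M w R ⊔
      ⨆ i, (ballSpace M w (R + 1 - k)).map (M i ^ k) := by
  rw [fr_ball_eq M w (R + 1), Submodule.span_le]
  rintro v ⟨l, hl, rfl⟩
  by_cases hlR : l.length ≤ R
  · exact Submodule.mem_sup_left (fr_mem_ball M w l hlR)
  · have hlen : l.length = R + 1 := by omega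
    obtain ⟨i, hi⟩ := fr_pigeon hn l k (by omega)
    rw [← List.replicate_sublist_iff] at hi
    obtain ⟨l', hp⟩ := hi.exists_perm_append
    have e := fr_perm M w (R + 1) h _ _ hp hl
    refine Submodule.mem_sup_right (Submodule.mem_iSup_of_mem i ?_)
    have hle := hp.length_eq
    simp at hle
    refine ⟨(l'.map M).prod w, fr_mem_ball M w l' (by omega), ?_⟩
    rw [e]
    simp

lemma fr_compl [FiniteDimensional ℂ V] {K N : Submodule ℂ V} (h : K ≤ N) :
    ∃ C : Submodule ℂ V, K ⊔ C = N ∧ finrank ℂ K + finrank ℂ C = finrank ℂ N := by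
  obtain ⟨Q, hQ⟩ := K.exists_isCompl
  have e : K ⊔ Q ⊓ N = N := by
    rw [← sup_inf_assoc_of_le _ h, hQ.sup_eq_top, top_inf_eq]
  refine ⟨Q ⊓ N, e, ?_⟩
  have := Submodule.finrank_sup_add_finrank_inf_eq K (Q ⊓ N)
  rw [e, ← inf_assoc, hQ.inf_eq_bot, bot_inf_eq] at this
  simpa using this.symm

lemma fr_finrank_iSup [FiniteDimensional ℂ V] {ι : Type*} [Fintype ι] (N : ι → Submodule ℂ V) :
    finrank ℂ (⨆ i, N i : Submodule ℂ V) ≤ ∑ i, finrank ℂ (N i) := by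
  classical
  rw [← Finset.sup_univ_eq_iSup]
  induction (Finset.univ : Finset ι) using Finset.induction_on with
  | empty => simp
  | insert a s ha ih =>
    rw [Finset.sup_insert, Finset.sum_insert ha]
    exact (Submodule.finrank_add_le_finrank_add_finrank _ _).trans (by omega)

lemma fr_growth1 [FiniteDimensional ℂ V] {n : ℕ} (hn : 0 < n) (M : Fin n → Module.End ℂ V) (w : V)
    (R : ℕ) (h : IsRegularBall M w (R + 1)) (k : ℕ) (hk : k * n ≤ R + 1) (hk' : k ≤ R) :
    finrank ℂ (ballSpace M w (R + 1)) + n * finrank ℂ (ballSpace M w (R - k)) ≤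
      finrank ℂ (ballSpace M w R) + n * finrank ℂ (ballSpace M w (R + 1 - k)) := by
  obtain ⟨C, hC, hCr⟩ := fr_compl (fr_ball_mono M w (show R - k ≤ R + 1 - k by omega))
  have hc : ballSpace M w (R + 1) ≤ ballSpace M w R ⊔ ⨆ i, C.map (M i ^ k) := by
    refine (fr_cover hn M w R h k hk hk').trans (sup_le le_sup_left (iSup_le fun i => ?_))
    rw [← hC, Submodule.map_sup]
    refine sup_le ?_ ((le_iSup (fun i => C.map (M i ^ k)) i).trans le_sup_right)
    refine le_trans ?_ le_sup_left
    rintro _ ⟨v, hv, rfl⟩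
    have := fr_ball_pow M w i k hv
    rwa [Nat.sub_add_cancel hk'] at this
  have h1 := Submodule.finrank_mono hc
  have h2 := Submodule.finrank_add_le_finrank_add_finrank (ballSpace M w R)
    (⨆ i, C.map (M i ^ k))
  have h3 := fr_finrank_iSup (fun i => C.map (M i ^ k))
  have h4 : ∑ i, finrank ℂ (C.map (M i ^ k)) ≤ ∑ _i : Fin n, finrank ℂ C :=
    Finset.sum_le_sum fun i _ => Submodule.finrank_map_le _ _
  simp at h4
  rw [← hCr]
  nlinarith

lemma fr_growth [FiniteDimensional ℂ V] {n : ℕ} (hn : 0 < n) (M : Fin n → Module.End ℂ V) (w : V)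
    (R : ℕ) (h : IsRegularBall M w (R + 1)) (q : ℕ) (hq : q * n ≤ R + 1) :
    q * finrank ℂ (ballSpace M w (R + 1)) ≤
      q * finrank ℂ (ballSpace M w R) + n * finrank ℂ (ballSpace M w (R + 1)) := by
  have key : ∀ m : ℕ, m ≤ q →
      m * finrank ℂ (ballSpace M w (R + 1)) + n * finrank ℂ (ballSpace M w (R + 1 - m)) ≤
      m * finrank ℂ (ballSpace M w R) + n * finrank ℂ (ballSpace M w (R + 1)) := by
    intro m
    induction m with
    | zero => simp
    | succ m ih =>
      intro hm
      have i1 := ih (by omega)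
      have : (m + 1) * 1 ≤ q * n := Nat.mul_le_mul hm hn
      have h2 : m * n ≤ q * n := Nat.mul_le_mul (by omega) le_rfl
      have i2 := fr_growth1 hn M w R h m (by omega) (by omega)
      rw [show R + 1 - (m + 1) = R - m by omega]
      nlinarith
  have := key q le_rfl
  omega

/-- local diagonalisation data -/
def FrPiece {n : ℕ} (M : Fin n → Module.End ℂ V) (N : Submodule ℂ V) (r : ℕ) : Prop :=
  ∃ (D : ℕ) (b : Basis (Fin D) ℂ N) (c : Fin D → Fin n → ℂ) (K C : Submodule ℂ V),
    K ≤ N ∧ N ≤ K ⊔ C ∧ finrank ℂ C ≤ r ∧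
    ∀ (i : Fin n) (v : N), (v : V) ∈ K → M i v = ∑ k, (c k i * b.repr v k) • (b k : V)

lemma fr_piece_triv [FiniteDimensional ℂ V] {n : ℕ} (M : Fin n → Module.End ℂ V)
    (N : Submodule ℂ V) : FrPiece M N (finrank ℂ N) := by
  refine ⟨_, finBasis ℂ N, 0, ⊥, N, bot_le, le_sup_right, le_rfl, ?_⟩
  intro i v hv
  rw [Submodule.mem_bot] at hv
  simp [hv]

lemma fr_dual [FiniteDimensional ℂ V] {ι : Type*} (ℓ : ι → Module.Dual ℂ V)
    (h : ∀ v, (∀ z, ℓ z v = 0) → v = 0) :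
    ∃ (D : ℕ) (a : Fin D → ι) (b : Basis (Fin D) ℂ V), ∀ v k, b.repr v k = ℓ (a k) v := by
  classical
  obtain ⟨κ, a, -, hs, hl⟩ := exists_linearIndependent' ℂ ℓ
  have htop : Submodule.span ℂ (Set.range ℓ) = ⊤ := by
    rw [← Subspace.dualCoannihilator_dualAnnihilator_eq (W := Submodule.span ℂ (Set.range ℓ)),
      Submodule.dualAnnihilator_eq_top_iff, eq_bot_iff]
    intro v hv
    rw [Submodule.mem_bot]
    apply h
    intro z
    rw [Submodule.mem_dualCoannihilator] at hv
    exact hv _ (Submodule.subset_span ⟨z, rfl⟩)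
  let B : Basis κ ℂ (Module.Dual ℂ V) := Basis.mk hl (by rw [hs, htop])
  have : Fintype κ := FiniteDimensional.fintypeBasisIndex B
  let e := Fintype.equivFin κ
  let b' : Basis κ ℂ V := B.dualBasis.map (Module.evalEquiv ℂ V).symm
  refine ⟨Fintype.card κ, a ∘ e.symm, b'.reindex e, ?_⟩
  have hrep : ∀ v k, b'.repr v k = ℓ (a k) v := by
    intro v k
    simp only [b', Basis.map_repr, LinearEquiv.trans_apply, LinearEquiv.symm_symm]
    rw [Basis.dualBasis_repr]
    simp [B]
  intro v k
  simp [hrep]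

lemma fr_piece_ball [FiniteDimensional ℂ V] {n : ℕ} (M : Fin n → Module.End ℂ V) (w : V) (R : ℕ)
    (h : IsRegularBall M w (R + 1)) :
    FrPiece M (ballSpace M w (R + 1))
      (finrank ℂ (ballSpace M w (R + 1)) - finrank ℂ (ballSpace M w R)) := by
  obtain ⟨𝔞, φ, h1, h2⟩ := h
  have hmono := fr_ball_mono M w (show R ≤ R + 1 by omega)
  obtain ⟨C, hC, hCr⟩ := fr_compl hmono
  let ev : zeroLocus ℂ 𝔞 → (MvPolynomial (Fin n) ℂ ⧸ 𝔞) →ₐ[ℂ] ℂ := fun z =>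
    Ideal.Quotient.liftₐ 𝔞 (aeval (z : Fin n → ℂ)) (fun f hf => z.2 f hf)
  have hev : ∀ z f, ev z (Ideal.Quotient.mk 𝔞 f) = aeval (z : Fin n → ℂ) f := fun z f => rfl
  let ℓ : zeroLocus ℂ 𝔞 → Module.Dual ℂ (ballSpace M w (R + 1)) := fun z =>
    (ev z).toLinearMap ∘ₗ (Fdeg n 𝔞 (R + 1)).subtype ∘ₗ φ.toLinearMap
  have hℓ : ∀ z v, ℓ z v = ev z (φ v : MvPolynomial (Fin n) ℂ ⧸ 𝔞) := fun z v => rfl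
  obtain ⟨D, a, b, hb⟩ := fr_dual ℓ (by
    intro v hv
    have h0 : (φ v : MvPolynomial (Fin n) ℂ ⧸ 𝔞) = 0 := by
      apply h2 _ (φ v).2
      obtain ⟨f, hf⟩ := Ideal.Quotient.mk_surjective (φ v : MvPolynomial (Fin n) ℂ ⧸ 𝔞)
      rw [← hf]
      apply Ideal.mem_map_of_mem
      rw [← vanishingIdeal_zeroLocus_eq_radical (K := ℂ), mem_vanishingIdeal_iff]
      intro x hx
      have := hv ⟨x, hx⟩
      rw [hℓ, ← hf, hev] at this
      exact this
    have : φ v = 0 := Subtype.ext h0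
    simpa using this)
  refine ⟨D, b, fun k i => (a k : Fin n → ℂ) i, _, C, hmono, hC.ge, by omega, ?_⟩
  intro i v hv
  have hMv := fr_ball_step M w i hv
  have e := h1 R rfl i v hv v.2 hMv
  have hk : ∀ k, b.repr ⟨M i v, hMv⟩ k = (a k : Fin n → ℂ) i * b.repr v k := by
    intro k
    rw [hb, hb, hℓ, e, hℓ, muX, LinearMap.mulLeft_apply, map_mul, hev, aeval_X]
  have := congrArg Subtype.val (b.sum_repr ⟨M i v, hMv⟩)
  simp only [hk, Submodule.coe_sum, Submodule.coe_smul] at this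
  exact this.symm

lemma fr_glue [FiniteDimensional ℂ V] {n : ℕ} (M : Fin n → Module.End ℂ V) {ι : Type} [Fintype ι]
    [DecidableEq ι] (N : ι → Submodule ℂ V) (hN : DirectSum.IsInternal N) (r : ι → ℕ)
    (hp : ∀ j, FrPiece M (N j) (r j)) :
    ∃ (A : Fin n → Module.End ℂ V) (b : Basis (Fin (finrank ℂ V)) ℂ V),
      (∀ j i, ∃ c : ℂ, A i (b j) = c • b j) ∧
      ∀ i, finrank ℂ (LinearMap.range (M i - A i)) ≤ ∑ j, r j := by
  choose D b c K C hKN hNC hCr hM using hp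
  let B := hN.collectedBasis b
  have hB : ∀ j k, B ⟨j, k⟩ = (b j k : V) := fun j k => by simp [B]
  let A : Fin n → Module.End ℂ V := fun i => B.constr ℂ (fun p => c p.1 p.2 i • B p)
  have hA : ∀ i p, A i (B p) = c p.1 p.2 i • B p := fun i p => by simp [A]
  let e : (Σ j, Fin (D j)) ≃ Fin (finrank ℂ V) := Fintype.equivFinOfCardEq
    (Module.finrank_eq_card_basis B).symm
  refine ⟨A, B.reindex e, ?_, ?_⟩
  · intro j i
    exact ⟨c (e.symm j).1 (e.symm j).2 i, by simp [hA]⟩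
  · intro i
    have hAv : ∀ j (v : N j), A i v = ∑ k, (c j k i * (b j).repr v k) • (b j k : V) := by
      intro j v
      have e1 := congrArg Subtype.val ((b j).sum_repr v)
      simp only [Submodule.coe_sum, Submodule.coe_smul] at e1
      conv_lhs => rw [← e1]
      rw [map_sum]
      refine Finset.sum_congr rfl fun k _ => ?_
      rw [map_smul, ← hB, hA, smul_smul, mul_comm]
    have hr : LinearMap.range (M i - A i) ≤ ⨆ j, (C j).map (M i - A i) := by
      rw [LinearMap.range_eq_map, ← hN.submodule_iSup_eq_top, Submodule.map_iSup]
      refine iSup_mono fun j => ?_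
      refine (Submodule.map_mono (hNC j)).trans ?_
      rw [Submodule.map_sup]
      refine sup_le ?_ le_rfl
      rintro _ ⟨v, hv, rfl⟩
      have h1 := hM j i ⟨v, hKN j hv⟩ hv
      have h2 := hAv j ⟨v, hKN j hv⟩
      have : (M i - A i) v = 0 := by
        rw [LinearMap.sub_apply, sub_eq_zero]
        exact h1.trans h2.symm
      rw [this]
      exact Submodule.zero_mem _
    refine (Submodule.finrank_mono hr).trans ((fr_finrank_iSup _).trans ?_)
    exact Finset.sum_le_sum fun j _ => (Submodule.finrank_map_le _ _).trans (hCr j)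

lemma fr_internal {k : ℕ} (N : Fin k → Submodule ℂ V) (hN : iSupIndep N) (Q : Submodule ℂ V)
    (hQ : IsCompl (⨆ j, N j) Q) :
    DirectSum.IsInternal (fun o : Option (Fin k) => o.elim Q N) := by
  classical
  apply DirectSum.isInternal_submodule_of_iSupIndep_of_iSup_eq_top
  · rw [iSupIndep_def]
    intro o
    cases o with
    | none =>
      refine hQ.symm.disjoint.mono_right (iSup₂_le fun o ho => ?_)
      cases o with
      | none => exact absurd rfl ho
      | some j => exact le_iSup N j
    | some j =>
      have hle : (⨆ (o : Option (Fin k)) (_ : o ≠ some j), (o.elim Q N : Submodule ℂ V)) ≤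
          (⨆ (i) (_ : i ≠ j), N i) ⊔ Q := by
        refine iSup₂_le fun o ho => ?_
        cases o with
        | none => exact le_sup_right
        | some i =>
          exact (le_iSup₂_of_le (f := fun i (_ : i ≠ j) => N i) i (by simpa using ho)
            le_rfl).trans le_sup_left
      refine Disjoint.mono_right hle ?_
      have h1 := hN j
      refine Disjoint.disjoint_sup_right_of_disjoint_sup_left h1 ?_
      refine hQ.disjoint.mono_left (sup_le (le_iSup N j) (iSup₂_le fun i _ => le_iSup N i))
  · rw [iSup_option]
    simpa [sup_comm] using hQ.sup_eq_top

lemma fr_sum_finrank [FiniteDimensional ℂ V] {ι : Type} [Fintype ι]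
    [DecidableEq ι] (N : ι → Submodule ℂ V) (hN : DirectSum.IsInternal N) :
    ∑ j, finrank ℂ (N j) = finrank ℂ V := by
  rw [Module.finrank_eq_card_basis (hN.collectedBasis fun j => finBasis ℂ (N j))]
  simp

end helpers

theorem first_reduction (n : ℕ) (hn : 0 < n) (ε : ℝ) (hε : 0 < ε) :
    ∃ (R : ℕ) (δ : ℝ), 0 < δ ∧
      ∀ (d : ℕ), 0 < d →
        ∀ (M : Fin n → Matrix (Fin d) (Fin d) ℂ) (W : Submodule ℂ (Fin d → ℂ)),
          IsMultiBall (fun i => (M i).mulVecLin) R W →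
          (1 - δ) * d ≤ (finrank ℂ W : ℝ) →
          ∃ A : Fin n → Matrix (Fin d) (Fin d) ℂ,
            (∃ b : Basis (Fin d) ℂ (Fin d → ℂ),
              ∀ (j : Fin d) (i : Fin n), ∃ c : ℂ, (A i).mulVec (b j) = c • b j) ∧
            ∀ i, ((M i - A i).rank : ℝ) / d ≤ 2 * ε := by
  obtain ⟨q, hq⟩ := exists_nat_ge ((n : ℝ) / ε)
  refine ⟨q * n + 1, ε, hε, ?_⟩
  intro d hd M W hW hdim
  obtain ⟨k, w, Rad, hR, -, hreg, hWs, hind⟩ := hW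
  set L : Fin n → Module.End ℂ (Fin d → ℂ) := fun i => (M i).mulVecLin with hL
  obtain ⟨Q, hQ⟩ := W.exists_isCompl
  have hQW := Submodule.finrank_add_eq_of_isCompl hQ
  have hint := fr_internal _ hind Q (by rw [← hWs]; exact hQ)
  choose S hS using fun j => Nat.exists_eq_add_of_le' (show 1 ≤ Rad j from
    (Nat.le_add_left 1 _).trans (hR j))
  have hpiece : ∀ o : Option (Fin k),
      FrPiece L (o.elim Q (fun j => ballSpace L (w j) (Rad j)))
        (o.elim (finrank ℂ Q) (fun j => finrank ℂ (ballSpace L (w j) (Rad j)) -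
          finrank ℂ (ballSpace L (w j) (S j)))) := by
    intro o
    cases o with
    | none => exact fr_piece_triv L Q
    | some j =>
      have := fr_piece_ball L (w j) (S j) (by rw [← hS]; exact hreg j)
      rw [← hS] at this
      exact this
  obtain ⟨A, b, hAb, hrank⟩ := fr_glue L _ hint _ hpiece
  have hfd : finrank ℂ (Fin d → ℂ) = d := by simp
  have hsum := fr_sum_finrank _ hint
  rw [Fintype.sum_option] at hsum
  simp only [Option.elim] at hsum
  refine ⟨fun i => LinearMap.toMatrix' (A i), ⟨b.reindex (finCongr hfd), ?_⟩, ?_⟩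
  · intro j i
    obtain ⟨c, hc⟩ := hAb ((finCongr hfd).symm j) i
    refine ⟨c, ?_⟩
    rw [LinearMap.toMatrix'_mulVec, Basis.reindex_apply, hc]
  · intro i
    have h1 := hrank i
    have h2 : (M i - LinearMap.toMatrix' (A i)).rank = finrank ℂ (LinearMap.range (L i - A i)) := by
      have h0 : (M i - LinearMap.toMatrix' (A i)).mulVecLin = L i - A i := by
        refine LinearMap.ext fun v => ?_
        rw [Matrix.mulVecLin_apply, Matrix.sub_mulVec, LinearMap.toMatrix'_mulVec]
        rfl
      rw [Matrix.rank, h0]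
    rw [Fintype.sum_option, ← h2] at h1
    simp only [Option.elim] at h1
    have hd' : (0 : ℝ) < d := by exact_mod_cast hd
    rw [div_le_iff₀ hd']
    have h3 : ∀ j, ((finrank ℂ (ballSpace L (w j) (Rad j)) -
          finrank ℂ (ballSpace L (w j) (S j)) : ℕ) : ℝ) ≤
          ε * (finrank ℂ (ballSpace L (w j) (Rad j)) : ℝ) := by
      intro j
      have hg := fr_growth hn L (w j) (S j) (by rw [← hS]; exact hreg j) q
        (by have := hR j; have := hS j; omega)
      have hm := Submodule.finrank_mono (fr_ball_mono L (w j) (show S j ≤ Rad j by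
        have := hS j; omega))
      rw [← hS] at hg
      rw [Nat.cast_sub hm]
      have hg' : (q : ℝ) * (finrank ℂ (ballSpace L (w j) (Rad j)) : ℝ) ≤
        q * (finrank ℂ (ballSpace L (w j) (S j)) : ℝ) +
          n * (finrank ℂ (ballSpace L (w j) (Rad j)) : ℝ) := by exact_mod_cast hg
      have hn' : (0 : ℝ) < n := by exact_mod_cast hn
      have hq0 : (0 : ℝ) < q := lt_of_lt_of_le (div_pos hn' hε) hq
      rw [div_le_iff₀ hε] at hq
      refine le_of_mul_le_mul_left ?_ hq0
      have : (n : ℝ) * (finrank ℂ (ballSpace L (w j) (Rad j)) : ℝ) ≤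
        q * ε * (finrank ℂ (ballSpace L (w j) (Rad j)) : ℝ) :=
        mul_le_mul_of_nonneg_right hq (Nat.cast_nonneg _)
      nlinarith
    have h4 : ((M i - LinearMap.toMatrix' (A i)).rank : ℝ) ≤ finrank ℂ Q +
        ∑ j, ε * (finrank ℂ (ballSpace L (w j) (Rad j)) : ℝ) := by
      refine le_trans (Nat.cast_le.mpr h1) ?_
      push_cast
      exact add_le_add le_rfl (Finset.sum_le_sum fun j _ => h3 j)
    rw [← Finset.mul_sum] at h4
    rw [hfd] at hsum hQW
    have h5 : (finrank ℂ Q : ℝ) + ∑ j, (finrank ℂ (ballSpace L (w j) (Rad j)) : ℝ) = d := by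
      exact_mod_cast hsum
    have h6 : (finrank ℂ W : ℝ) + finrank ℂ Q = d := by exact_mod_cast hQW
    have h7 : (0 : ℝ) ≤ finrank ℂ Q := Nat.cast_nonneg _
    nlinarith
end

section
/- Fix n ∈ ℕ₊. For every R ∈ ℕ and ε > 0 there exists η > 0 such that for every d ∈ ℕ₊ and every η-commuting tuple 𝒰 = (U₁, …, Uₙ) of d×d complex matrices, there exists a subspace W ⊆ ℂ^d such that 𝒰 is R-commutative on W and dim(W) ≥ d(1−ε). -/
open Matrix Module

variable {V : Type*} [AddCommGroup V] [Module ℂ V]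

/-- `ℳ` is `r`-commutative at `v`: for every word `α` of length `q ≤ r` and every
permutation `σ` of `[q]`, `ℳ_α(v) = ℳ_{α∘σ}(v)`. -/
def RCommAt {n : ℕ} (M : Fin n → Module.End ℂ V) (r : ℕ) (v : V) : Prop :=
  ∀ (q : ℕ), q ≤ r → ∀ (α : Fin q → Fin n) (σ : Equiv.Perm (Fin q)),
    mword M α v = mword M (α ∘ σ) v

theorem codim_iInf {ι : Type*} (d : ℕ) (K : ι → Submodule ℂ (Fin d → ℂ)) (c : ℝ)
    (hK : ∀ i, (d : ℝ) - c ≤ finrank ℂ (K i)) (s : Finset ι) :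
    (d : ℝ) - s.card * c ≤ finrank ℂ (s.inf K : Submodule ℂ (Fin d → ℂ)) := by
  classical
  induction s using Finset.induction_on with
  | empty => rw [Finset.inf_empty, finrank_top, Module.finrank_fin_fun]; simp
  | insert a s ha ih =>
    rw [Finset.inf_insert, Finset.card_insert_of_notMem ha]
    have h := Submodule.finrank_sup_add_finrank_inf_eq (K a) (s.inf K)
    have h2 := Submodule.finrank_le (K a ⊔ s.inf K)
    rw [Module.finrank_fin_fun] at h2
    have h3 := hK a
    have h' : (finrank ℂ ↥(K a ⊔ s.inf K) : ℝ) + finrank ℂ ↥(K a ⊓ s.inf K)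
      = finrank ℂ (K a) + finrank ℂ ↥(s.inf K) := by exact_mod_cast h
    have h2' : (finrank ℂ ↥(K a ⊔ s.inf K) : ℝ) ≤ d := by exact_mod_cast h2
    push_cast
    linarith

theorem perm_apply {d n : ℕ} (M : Fin n → Module.End ℂ (Fin d → ℂ)) (R : ℕ) (v : Fin d → ℂ)
    (h : ∀ i j, ∀ l : List (Fin n), l.length ≤ R →
      (M i * M j) ((l.map M).prod v) = (M j * M i) ((l.map M).prod v))
    {l₁ l₂ : List (Fin n)} (hp : l₁.Perm l₂) (hl : l₁.length ≤ R) :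
    (l₁.map M).prod v = (l₂.map M).prod v := by
  induction hp with
  | nil => rfl
  | cons x _ ih =>
    simp only [List.length_cons] at hl
    simp only [List.map_cons, List.prod_cons, Module.End.mul_apply]
    rw [ih (by omega)]
  | swap x y l =>
    simp only [List.length_cons] at hl
    have := h y x l (by omega)
    simpa only [List.map_cons, List.prod_cons, Module.End.mul_apply] using this
  | trans h1 _ ih1 ih2 => rw [ih1 hl, ih2 (h1.length_eq ▸ hl)]

/-- **Lemma.** Fix `n ∈ ℕ₊`. For every `R ∈ ℕ` and `ε > 0` there exists `η > 0` such that
every `η`-commuting tuple `𝒰` of `d×d` complex matrices is `R`-commutative on a subspace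
`W ⊆ ℂ^d` with `dim W ≥ d(1−ε)`. -/
theorem r_commutative_subspace (n : ℕ) (hn : 0 < n) (R : ℕ) (ε : ℝ) (hε : 0 < ε) :
    ∃ η : ℝ, 0 < η ∧
      ∀ (d : ℕ), 0 < d →
        ∀ U : Fin n → Matrix (Fin d) (Fin d) ℂ,
          (∀ i j, ((U i * U j - U j * U i).rank : ℝ) / d ≤ η) →
          ∃ W : Submodule ℂ (Fin d → ℂ),
            (∀ v ∈ W, RCommAt (fun i => (U i).mulVecLin) R v) ∧
            (d : ℝ) * (1 - ε) ≤ finrank ℂ W := by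
  classical
  let I := Fin n × Fin n × (Σ q : Fin (R + 1), Fin q → Fin n)
  have hN : (0 : ℝ) < (Fintype.card I : ℝ) + 1 := by positivity
  refine ⟨ε / ((Fintype.card I : ℝ) + 1), by positivity, ?_⟩
  intro d hd U hU
  have hd' : (0 : ℝ) < d := by exact_mod_cast hd
  set η := ε / ((Fintype.card I : ℝ) + 1) with hη
  set M : Fin n → Module.End ℂ (Fin d → ℂ) := fun i => (U i).mulVecLin with hM
  let K : I → Submodule ℂ (Fin d → ℂ) := fun x =>
    LinearMap.ker ((M x.1 * M x.2.1 - M x.2.1 * M x.1) * ((List.ofFn x.2.2.2).map M).prod)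
  have hK : ∀ x, (d : ℝ) - η * d ≤ finrank ℂ (K x) := by
    rintro ⟨i, j, q, β⟩
    have h1 := LinearMap.finrank_range_add_finrank_ker
      ((M i * M j - M j * M i) * ((List.ofFn β).map M).prod)
    rw [Module.finrank_fin_fun] at h1
    have h2 : finrank ℂ (LinearMap.range ((M i * M j - M j * M i) * ((List.ofFn β).map M).prod))
        ≤ (U i * U j - U j * U i).rank := by
      have e : M i * M j - M j * M i = (U i * U j - U j * U i).mulVecLin := by
        ext v
        simp [hM, Matrix.sub_mulVec]
      rw [Matrix.rank, ← e]
      exact Submodule.finrank_mono (LinearMap.range_comp_le_range _ _)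
    have h3 := hU i j
    rw [div_le_iff₀ hd'] at h3
    have h1' : (finrank ℂ (LinearMap.range
        ((M i * M j - M j * M i) * ((List.ofFn β).map M).prod)) : ℝ)
        + finrank ℂ (K ⟨i, j, q, β⟩) = d := by exact_mod_cast h1
    have h2' : (finrank ℂ (LinearMap.range
        ((M i * M j - M j * M i) * ((List.ofFn β).map M).prod)) : ℝ)
        ≤ ((U i * U j - U j * U i).rank : ℝ) := by exact_mod_cast h2
    linarith
  refine ⟨Finset.univ.inf K, ?_, ?_⟩
  · intro v hv q hq α σ
    have key : ∀ i j, ∀ l : List (Fin n), l.length ≤ R →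
        (M i * M j) ((l.map M).prod v) = (M j * M i) ((l.map M).prod v) := by
      intro i j l hl
      have hle : Finset.univ.inf K ≤ K ⟨i, j, ⟨l.length, by omega⟩, l.get⟩ :=
        Finset.inf_le (Finset.mem_univ _)
      have := hle hv
      simp only [K, LinearMap.mem_ker, Module.End.mul_apply, LinearMap.sub_apply,
        List.ofFn_get] at this
      simpa only [Module.End.mul_apply] using sub_eq_zero.1 this
    have hp : (List.ofFn α).Perm (List.ofFn (α ∘ σ)) := (Equiv.Perm.ofFn_comp_perm σ α).symm
    have := perm_apply M R v key hp (by simpa using hq)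
    simpa only [mword, List.map_ofFn, Function.comp_def] using this
  · have h := codim_iInf d K (η * d) hK Finset.univ
    rw [Finset.card_univ] at h
    have : (Fintype.card I : ℝ) * η ≤ ε := by
      have : ((Fintype.card I : ℝ) + 1) * η = ε := by rw [hη]; field_simp
      have h0 : 0 < η := by positivity
      linarith
    nlinarith
end

section
/- Fix n ∈ ℕ₊ and let K : ℕ → ℕ be any function satisfying the conclusion of the effective Nullstellensatz in n variables, namely: for every R and all polynomials f, f₁, …, f_k ∈ ℂ[X₁, …, Xₙ] of degree at most R, with 𝔞 the ideal generated by f₁, …, f_k, (i) if f ∈ 𝔞 then there exist h₁, …, h_k with Σ hᵢfᵢ = f and deg(hᵢfᵢ) ≤ K(R), and (ii) if f ∈ rad(𝔞) then there exist m ∈ ℕ and g₁, …, g_k with Σ gᵢfᵢ = f^m and deg(gᵢfᵢ) ≤ K(R). Then: for every d ∈ ℕ₊, every ∗-closed tuple ℳ = (M₁, …, Mₙ) of d×d complex matrices, every R ≥ 0 and every v ∈ ℂ^d such that ℳ is (2·K(R))-commutative at v, the ballspace B_ℳ(v, R) is regular. -/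
open MvPolynomial Module Matrix

variable {V : Type*} [AddCommGroup V] [Module ℂ V]

/-- `K : ℕ → ℕ` satisfies the conclusion of the effective Nullstellensatz in `n` variables. -/
def EffNullFunction (n : ℕ) (K : ℕ → ℕ) : Prop :=
  ∀ (R k : ℕ) (f : MvPolynomial (Fin n) ℂ) (F : Fin k → MvPolynomial (Fin n) ℂ),
    f.totalDegree ≤ R → (∀ i, (F i).totalDegree ≤ R) →
    ((f ∈ Ideal.span (Set.range F) →
        ∃ h : Fin k → MvPolynomial (Fin n) ℂ,
          (∑ i, h i * F i) = f ∧ ∀ i, (h i * F i).totalDegree ≤ K R) ∧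
     (f ∈ (Ideal.span (Set.range F)).radical →
        ∃ (m : ℕ) (g : Fin k → MvPolynomial (Fin n) ℂ),
          (∑ i, g i * F i) = f ^ m ∧ ∀ i, (g i * F i).totalDegree ≤ K R))

section Aux

variable {n d : ℕ}

/-- product of matrices along a list -/
def wd (M : Fin n → Matrix (Fin d) (Fin d) ℂ) (l : List (Fin n)) : Matrix (Fin d) (Fin d) ℂ :=
  (l.map M).prod

theorem mword_eq (M : Fin n → Matrix (Fin d) (Fin d) ℂ) {q : ℕ} (α : Fin q → Fin n)
    (v : Fin d → ℂ) :
    mword (fun i => (M i).mulVecLin) α v = wd M (List.ofFn α) *ᵥ v := by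
  have key : ∀ l : List (Fin n),
      (l.map (fun i => (M i).mulVecLin)).prod v = wd M l *ᵥ v := by
    intro l
    induction l with
    | nil => simp [wd]
    | cons a l ih =>
      simp only [List.map_cons, List.prod_cons, Module.End.mul_apply, ih, wd,
        Matrix.mulVecLin_apply, Matrix.mulVec_mulVec]
  rw [← key, List.map_ofFn]
  rfl

theorem wd_perm {M : Fin n → Matrix (Fin d) (Fin d) ℂ} {r : ℕ} {v : Fin d → ℂ}
    (hcomm : RCommAt (fun i => (M i).mulVecLin) r v) {l l' : List (Fin n)}
    (h : l.Perm l') (hl : l.length ≤ r) : wd M l *ᵥ v = wd M l' *ᵥ v := by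
  have h1 : ∀ k : List (Fin n), k.length ≤ r →
      wd M k *ᵥ v = wd M (k.mergeSort (· ≤ ·)) *ᵥ v := by
    intro k hk
    have h2 := hcomm k.length hk k.get (Tuple.sort k.get)
    rw [mword_eq, mword_eq, List.ofFn_get] at h2
    rw [h2]
    congr 2
    refine List.Perm.eq_of_pairwise' (r := (· ≤ ·)) ?_ ?_ ?_
    · exact (Tuple.monotone_sort k.get).sortedLE_ofFn.pairwise
    · exact List.pairwise_mergeSort' _ _
    · refine (Equiv.Perm.ofFn_comp_perm _ _).trans ?_
      rw [List.ofFn_get]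
      exact (List.mergeSort_perm _ _).symm
  rw [h1 l hl, h1 l' (h.length_eq ▸ hl)]
  congr 2
  refine List.Perm.eq_of_pairwise' (r := (· ≤ ·)) (List.pairwise_mergeSort' _ _)
    (List.pairwise_mergeSort' _ _) ?_
  exact (List.mergeSort_perm _ _).trans (h.trans (List.mergeSort_perm _ _).symm)

/-- noncommutative evaluation, with a chosen order for each monomial -/
noncomputable def PM (M : Fin n → Matrix (Fin d) (Fin d) ℂ) :
    MvPolynomial (Fin n) ℂ →ₗ[ℂ] Matrix (Fin d) (Fin d) ℂ :=
  (basisMonomials (Fin n) ℂ).constr ℂ (fun s => wd M (Finsupp.toMultiset s).toList)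

theorem PM_monomial (M : Fin n → Matrix (Fin d) (Fin d) ℂ) (s : Fin n →₀ ℕ) (c : ℂ) :
    PM M (monomial s c) = c • wd M (Finsupp.toMultiset s).toList := by
  have : (monomial s c : MvPolynomial (Fin n) ℂ) = c • (basisMonomials (Fin n) ℂ) s := by
    simp [smul_monomial]
  rw [this, map_smul, PM, Basis.constr_basis]

/-- evaluation at the vector -/
noncomputable def ev (M : Fin n → Matrix (Fin d) (Fin d) ℂ) (v : Fin d → ℂ) :
    MvPolynomial (Fin n) ℂ →ₗ[ℂ] (Fin d → ℂ) where
  toFun p := PM M p *ᵥ v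
  map_add' p q := by rw [map_add, Matrix.add_mulVec]
  map_smul' c p := by rw [map_smul, Matrix.smul_mulVec]; rfl

theorem ev_apply (M : Fin n → Matrix (Fin d) (Fin d) ℂ) (v : Fin d → ℂ)
    (p : MvPolynomial (Fin n) ℂ) : ev M v p = PM M p *ᵥ v := rfl

theorem ev_monomial (M : Fin n → Matrix (Fin d) (Fin d) ℂ) (v : Fin d → ℂ)
    (s : Fin n →₀ ℕ) (c : ℂ) :
    ev M v (monomial s c) = c • (wd M (Finsupp.toMultiset s).toList *ᵥ v) := by
  rw [ev_apply, PM_monomial, Matrix.smul_mulVec]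

theorem card_le_of_mem {p : MvPolynomial (Fin n) ℂ} {s : Fin n →₀ ℕ} (h : s ∈ p.support) :
    Multiset.card (Finsupp.toMultiset s) ≤ p.totalDegree := by
  rw [totalDegree_eq]
  exact Finset.le_sup (f := fun m => Multiset.card (Finsupp.toMultiset m)) h

theorem ev_monomial_of_perm {M : Fin n → Matrix (Fin d) (Fin d) ℂ} {r : ℕ} {v : Fin d → ℂ}
    (hcomm : RCommAt (fun i => (M i).mulVecLin) r v) (s : Fin n →₀ ℕ) (c : ℂ)
    (l : List (Fin n)) (hl : (l : Multiset (Fin n)) = Finsupp.toMultiset s)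
    (hr : l.length ≤ r) :
    ev M v (monomial s c) = c • (wd M l *ᵥ v) := by
  rw [ev_monomial]
  congr 1
  refine (wd_perm hcomm ?_ hr).symm
  rw [← Multiset.coe_eq_coe, hl, Multiset.coe_toList]

theorem wd_append (M : Fin n → Matrix (Fin d) (Fin d) ℂ) (l l' : List (Fin n)) :
    wd M (l ++ l') = wd M l * wd M l' := by
  simp [wd]

/-- extension from monomials, bounded degree -/
theorem bilin_ext {r : ℕ} {E : Type*} [AddCommGroup E]
    (A B : MvPolynomial (Fin n) ℂ →+ MvPolynomial (Fin n) ℂ →+ E)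
    (h : ∀ s t c e, Multiset.card (Finsupp.toMultiset s) + Multiset.card (Finsupp.toMultiset t) ≤ r →
      A (monomial s c) (monomial t e) = B (monomial s c) (monomial t e))
    (p q : MvPolynomial (Fin n) ℂ) (hpq : p.totalDegree + q.totalDegree ≤ r) :
    A p q = B p q := by
  have hA : ∀ A : MvPolynomial (Fin n) ℂ →+ MvPolynomial (Fin n) ℂ →+ E,
      A p q = ∑ s ∈ p.support, ∑ t ∈ q.support,
        A (monomial s (coeff s p)) (monomial t (coeff t q)) := by
    intro A
    conv_lhs => rw [p.as_sum, q.as_sum]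
    simp only [map_sum, AddMonoidHom.finsetSum_apply]
    rw [Finset.sum_comm]
  rw [hA A, hA B]
  refine Finset.sum_congr rfl fun s hs => Finset.sum_congr rfl fun t ht => h _ _ _ _ ?_
  exact (add_le_add (card_le_of_mem hs) (card_le_of_mem ht)).trans hpq

theorem ev_mul {M : Fin n → Matrix (Fin d) (Fin d) ℂ} {r : ℕ} {v : Fin d → ℂ}
    (hcomm : RCommAt (fun i => (M i).mulVecLin) r v) (p q : MvPolynomial (Fin n) ℂ)
    (hpq : p.totalDegree + q.totalDegree ≤ r) :
    ev M v (p * q) = PM M p *ᵥ ev M v q := by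
  let A : MvPolynomial (Fin n) ℂ →+ MvPolynomial (Fin n) ℂ →+ (Fin d → ℂ) :=
    AddMonoidHom.mk' (fun p => AddMonoidHom.mk' (fun q => ev M v (p * q))
      (fun a b => by rw [mul_add, map_add]))
      (fun a b => by refine AddMonoidHom.ext fun q => ?_; simp [add_mul])
  let B : MvPolynomial (Fin n) ℂ →+ MvPolynomial (Fin n) ℂ →+ (Fin d → ℂ) :=
    AddMonoidHom.mk' (fun p => AddMonoidHom.mk' (fun q => PM M p *ᵥ ev M v q)
      (fun a b => by rw [map_add, Matrix.mulVec_add]))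
      (fun a b => by refine AddMonoidHom.ext fun q => ?_; simp [Matrix.add_mulVec])
  refine bilin_ext (r := r) A B ?_ p q hpq
  intro s t c e hst
  change ev M v (monomial s c * monomial t e) = PM M (monomial s c) *ᵥ ev M v (monomial t e)
  rw [monomial_mul, ev_monomial_of_perm hcomm (s + t) (c * e)
    ((Finsupp.toMultiset s).toList ++ (Finsupp.toMultiset t).toList)
    (by rw [← Multiset.coe_add, Multiset.coe_toList, Multiset.coe_toList, map_add])
    (by simpa using hst), PM_monomial, ev_monomial, wd_append, Matrix.smul_mulVec,
    Matrix.mulVec_smul, smul_smul, Matrix.mulVec_mulVec]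

/-- star polynomial -/
noncomputable def spoly (τ : Fin n → Fin n) (p : MvPolynomial (Fin n) ℂ) :
    MvPolynomial (Fin n) ℂ :=
  rename τ (map (starRingEnd ℂ) p)

theorem spoly_deg (τ : Fin n → Fin n) (p : MvPolynomial (Fin n) ℂ) :
    (spoly τ p).totalDegree ≤ p.totalDegree :=
  (totalDegree_rename_le _ _).trans (totalDegree_le_of_support_subset' p)
where
  totalDegree_le_of_support_subset' (p : MvPolynomial (Fin n) ℂ) :
    (map (starRingEnd ℂ) p).totalDegree ≤ p.totalDegree :=
  Finset.sup_mono (support_map_subset _ _)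

theorem wd_star {M : Fin n → Matrix (Fin d) (Fin d) ℂ} {τ : Fin n → Fin n}
    (hτ : ∀ i, (M i)ᴴ = M (τ i)) (l : List (Fin n)) :
    (wd M l)ᴴ = wd M (l.map τ).reverse := by
  rw [wd, Matrix.conjTranspose_list_prod, wd, List.map_map, List.map_reverse, List.map_map]
  congr 2
  exact List.map_congr_left fun i _ => hτ i

theorem ev_star {M : Fin n → Matrix (Fin d) (Fin d) ℂ} {r : ℕ} {v : Fin d → ℂ}
    (hcomm : RCommAt (fun i => (M i).mulVecLin) r v) {τ : Fin n → Fin n}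
    (hτ : ∀ i, (M i)ᴴ = M (τ i)) (p q : MvPolynomial (Fin n) ℂ)
    (hpq : p.totalDegree + q.totalDegree ≤ r) :
    (PM M p)ᴴ *ᵥ ev M v q = ev M v (spoly τ p * q) := by
  symm
  let A : MvPolynomial (Fin n) ℂ →+ MvPolynomial (Fin n) ℂ →+ (Fin d → ℂ) :=
    AddMonoidHom.mk' (fun p => AddMonoidHom.mk' (fun q => ev M v (spoly τ p * q))
      (fun a b => by rw [mul_add, map_add]))
      (fun a b => by refine AddMonoidHom.ext fun q => ?_; simp [add_mul, spoly])
  let B : MvPolynomial (Fin n) ℂ →+ MvPolynomial (Fin n) ℂ →+ (Fin d → ℂ) :=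
    AddMonoidHom.mk' (fun p => AddMonoidHom.mk' (fun q => (PM M p)ᴴ *ᵥ ev M v q)
      (fun a b => by rw [map_add, Matrix.mulVec_add]))
      (fun a b => by refine AddMonoidHom.ext fun q => ?_; simp [Matrix.add_mulVec])
  refine bilin_ext (r := r) A B ?_ p q hpq
  intro s t c e hst
  change ev M v (spoly τ (monomial s c) * monomial t e)
    = (PM M (monomial s c))ᴴ *ᵥ ev M v (monomial t e)
  rw [spoly, map_monomial, rename_monomial, monomial_mul, ev_monomial_of_perm hcomm _ _
    (((Finsupp.toMultiset s).toList.map τ).reverse ++ (Finsupp.toMultiset t).toList)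
    (by rw [← Multiset.coe_add, Multiset.coe_reverse, ← Multiset.map_coe, Multiset.coe_toList,
          Multiset.coe_toList, map_add, Finsupp.toMultiset_map])
    (by simpa using hst), PM_monomial, ev_monomial, wd_append, Matrix.conjTranspose_smul,
    Matrix.smul_mulVec, Matrix.mulVec_smul, smul_smul, wd_star hτ, Matrix.mulVec_mulVec]
  rfl

open scoped ComplexOrder in
theorem star_dot_zero {x : Fin d → ℂ} (h : star x ⬝ᵥ x = 0) : x = 0 :=
  dotProduct_star_self_eq_zero.1 h

theorem ev_pow_zero {M : Fin n → Matrix (Fin d) (Fin d) ℂ} {k : ℕ} {v : Fin d → ℂ}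
    (hcomm : RCommAt (fun i => (M i).mulVecLin) (2 * k) v) {τ : Fin n → Fin n}
    (hτ : ∀ i, (M i)ᴴ = M (τ i)) (f : MvPolynomial (Fin n) ℂ) (m : ℕ)
    (hdeg : (m + 1) * f.totalDegree ≤ k) (h : ev M v (f ^ (m + 1)) = 0) : ev M v f = 0 := by
  induction m with
  | zero => simpa using h
  | succ m ih =>
    have hs := spoly_deg τ f
    have hp := totalDegree_pow f m
    have hp1 := totalDegree_pow f (m + 1)
    have hp2 := totalDegree_pow f (m + 1 + 1)
    have e1 : (m + 1) * f.totalDegree = m * f.totalDegree + f.totalDegree := by ring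
    have e2 : (m + 1 + 1) * f.totalDegree = m * f.totalDegree + 2 * f.totalDegree := by ring
    apply ih (by lia)
    set g := f ^ (m + 1) with hg
    have hfg : f * g = f ^ (m + 1 + 1) := by rw [hg]; ring
    have hmul := totalDegree_mul (spoly τ f) g
    have a1 : ev M v (spoly τ f * g) = 0 := by
      refine star_dot_zero ?_
      have b1 := ev_star hcomm hτ f g (by lia)
      have b2 := ev_mul hcomm f (spoly τ f * g) (by lia)
      have b3 := ev_star hcomm hτ f (f * g) (by rw [hfg]; lia)
      have b5 : star (ev M v (spoly τ f * g)) ⬝ᵥ ev M v (spoly τ f * g)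
          = star ((PM M f)ᴴ *ᵥ ev M v g) ⬝ᵥ ev M v (spoly τ f * g) := by rw [b1]
      rw [b5, Matrix.star_mulVec, Matrix.conjTranspose_conjTranspose, ← Matrix.dotProduct_mulVec,
        ← b2, mul_left_comm, ← b3, hfg, h, Matrix.mulVec_zero, dotProduct_zero]
    have b1 := ev_star hcomm hτ f g (by lia)
    have b4 := ev_mul hcomm f (f ^ m) (by lia)
    have hfm : f * f ^ m = g := by rw [hg]; ring
    rw [hfm] at b4
    refine star_dot_zero ?_
    have : star (ev M v g) ⬝ᵥ ev M v g = star (PM M f *ᵥ ev M v (f ^ m)) ⬝ᵥ ev M v g := by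
      rw [← b4]
    rw [this, Matrix.star_mulVec, ← Matrix.dotProduct_mulVec, b1, a1, dotProduct_zero]

theorem ballSpace_eq_map {M : Fin n → Matrix (Fin d) (Fin d) ℂ} {r : ℕ} {v : Fin d → ℂ}
    (hcomm : RCommAt (fun i => (M i).mulVecLin) r v) {R : ℕ} (hR : R ≤ r) :
    ballSpace (fun i => (M i).mulVecLin) v R
      = (restrictTotalDegree (Fin n) ℂ R).map (ev M v) := by
  apply le_antisymm
  · refine Submodule.span_le.2 ?_
    rintro _ ⟨q, hq, α, rfl⟩
    have hs : (List.ofFn α : Multiset (Fin n))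
        = Finsupp.toMultiset (Multiset.toFinsupp (List.ofFn α : Multiset (Fin n))) := by simp
    refine ⟨monomial (Multiset.toFinsupp (List.ofFn α : Multiset (Fin n))) 1, ?_, ?_⟩
    · refine (mem_restrictTotalDegree _ _ _).2 ((totalDegree_monomial_le _ _).trans ?_)
      rw [← Finsupp.card_toMultiset, ← hs]
      simpa using hq
    · rw [ev_monomial_of_perm hcomm _ _ _ hs (by simpa using hq.trans hR), one_smul, mword_eq]
  · rintro _ ⟨p, hp, rfl⟩
    have hp := (mem_restrictTotalDegree _ _ _).1 hp
    rw [p.as_sum, map_sum]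
    refine Submodule.sum_mem _ fun s hs => ?_
    rw [ev_monomial]
    refine Submodule.smul_mem _ _ (Submodule.subset_span ?_)
    refine ⟨(Finsupp.toMultiset s).toList.length, ?_, (Finsupp.toMultiset s).toList.get, ?_⟩
    · rw [Multiset.length_toList]; exact (card_le_of_mem hs).trans hp
    · rw [mword_eq, List.ofFn_get]

theorem exists_equiv {D A B : Type*} [AddCommGroup D] [Module ℂ D] [AddCommGroup A] [Module ℂ A]
    [AddCommGroup B] [Module ℂ B] (e : D →ₗ[ℂ] A) (g : D →ₗ[ℂ] B) (SA : Submodule ℂ A)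
    (SB : Submodule ℂ B) (hA : SA = LinearMap.range e) (hB : SB = LinearMap.range g)
    (hk : LinearMap.ker e = LinearMap.ker g) :
    ∃ φ : SA ≃ₗ[ℂ] SB, ∀ x (h : e x ∈ SA), (φ ⟨e x, h⟩ : B) = g x := by
  subst hA hB
  refine ⟨e.quotKerEquivRange.symm.trans
    ((Submodule.quotEquivOfEq _ _ hk).trans g.quotKerEquivRange), ?_⟩
  intro x h
  have : e.quotKerEquivRange.symm ⟨e x, h⟩ = Submodule.Quotient.mk x := by
    rw [LinearEquiv.symm_apply_eq]; rfl
  rw [LinearEquiv.trans_apply, this]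
  rfl

end Aux

theorem ballspace_regular_of_commutative
    (n : ℕ) (hn : 0 < n) (K : ℕ → ℕ) (hK : EffNullFunction n K)
    (d : ℕ) (hd : 0 < d)
    (M : Fin n → Matrix (Fin d) (Fin d) ℂ)
    (hstar : ∀ i, ∃ j, (M i)ᴴ = M j)
    (R : ℕ) (v : Fin d → ℂ)
    (hcomm : RCommAt (fun i => (M i).mulVecLin) (2 * K R) v) :
    IsRegularBall (fun i => (M i).mulVecLin) v R := by
  choose τ hτ using hstar
  have hRK : R ≤ K R := by
    let x : MvPolynomial (Fin n) ℂ := X ⟨0, hn⟩ ^ R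
    have hx : x.totalDegree = R := totalDegree_X_pow _ _
    obtain ⟨h, h1, h2⟩ := (hK R 1 x (fun _ => x) hx.le (fun _ => hx.le)).1
      (Ideal.subset_span ⟨0, rfl⟩)
    have h3 := h2 0
    simp only [Fin.sum_univ_one] at h1
    rw [h1, hx] at h3
    exact h3
  let N : Set (MvPolynomial (Fin n) ℂ) := {f | f.totalDegree ≤ R ∧ ev M v f = 0}
  obtain ⟨k, F, hFN, hF⟩ : ∃ (k : ℕ) (F : Fin k → MvPolynomial (Fin n) ℂ),
      (∀ i, F i ∈ N) ∧ Ideal.span N = Ideal.span (Set.range F) := by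
    obtain ⟨S, hS, hS'⟩ := (Submodule.fg_span_iff_fg_span_finset_subset N).1
      (IsNoetherian.noetherian (Ideal.span N))
    refine ⟨S.card, fun i => (S.equivFin.symm i : MvPolynomial (Fin n) ℂ), fun i => hS ?_, ?_⟩
    · exact (S.equivFin.symm i).2
    · have : Set.range (fun i => (S.equivFin.symm i : MvPolynomial (Fin n) ℂ)) = (S : Set _) := by
        rw [show (fun i => (S.equivFin.symm i : MvPolynomial (Fin n) ℂ))
          = Subtype.val ∘ S.equivFin.symm from rfl, Set.range_comp, Equiv.range_eq_univ]
        simp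
      rw [this]; exact hS'
  have hcomb : ∀ h : Fin k → MvPolynomial (Fin n) ℂ, (∀ i, (h i * F i).totalDegree ≤ K R) →
      ev M v (∑ i, h i * F i) = 0 := by
    intro h hh
    rw [map_sum]
    refine Finset.sum_eq_zero fun i _ => ?_
    by_cases h0 : h i = 0
    · simp [h0]
    by_cases h1 : F i = 0
    · simp [h1]
    have := hh i
    rw [totalDegree_mul_of_isDomain h0 h1] at this
    rw [ev_mul hcomm _ _ (by lia), (hFN i).2, Matrix.mulVec_zero]
  have hker : ∀ f : MvPolynomial (Fin n) ℂ, f.totalDegree ≤ R →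
      f ∈ Ideal.span N → ev M v f = 0 := by
    intro f hf hfN
    rw [hF] at hfN
    obtain ⟨h, h1, h2⟩ := (hK R k f F hf (fun i => (hFN i).1)).1 hfN
    rw [← h1]
    exact hcomb h h2
  have hrad : ∀ f : MvPolynomial (Fin n) ℂ, f.totalDegree ≤ R →
      f ∈ (Ideal.span N).radical → ev M v f = 0 := by
    intro f hf hfN
    rw [hF] at hfN
    obtain ⟨m, g, h1, h2⟩ := (hK R k f F hf (fun i => (hFN i).1)).2 hfN
    have h3 := hcomb g h2
    rw [h1] at h3
    rcases m with _ | m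
    · have := ev_mul hcomm f 1 (by rw [totalDegree_one]; lia)
      rw [pow_zero] at h3
      rwa [h3, mul_one, Matrix.mulVec_zero] at this
    · refine ev_pow_zero hcomm hτ f m ?_ h3
      by_cases hf0 : f = 0
      · simp [hf0]
      have h4 : (f ^ (m + 1)).totalDegree ≤ K R := by
        rw [← h1]
        exact totalDegree_finsetSum_le fun i _ => h2 i
      have h5 : ∀ j, (f ^ j).totalDegree = j * f.totalDegree := by
        intro j
        induction j with
        | zero => simp
        | succ j ih =>
          rw [pow_succ, totalDegree_mul_of_isDomain (pow_ne_zero _ hf0) hf0, ih]; ring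
      rwa [h5] at h4
  have hballj : ∀ j ≤ R, ballSpace (fun i => (M i).mulVecLin) v j
      = (restrictTotalDegree (Fin n) ℂ j).map (ev M v) :=
    fun j hj => ballSpace_eq_map hcomm (by lia)
  obtain ⟨φ, hφ⟩ := exists_equiv
    ((ev M v).comp (restrictTotalDegree (Fin n) ℂ R).subtype)
    ((Ideal.Quotient.mkₐ ℂ (Ideal.span N)).toLinearMap.comp
      (restrictTotalDegree (Fin n) ℂ R).subtype)
    (ballSpace (fun i => (M i).mulVecLin) v R) (Fdeg n (Ideal.span N) R)
    (by rw [hballj R le_rfl, LinearMap.range_comp, Submodule.range_subtype])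
    (by rw [Fdeg, LinearMap.range_comp, Submodule.range_subtype])
    (by
      ext ⟨f, hf⟩
      have hf := (mem_restrictTotalDegree _ _ _).1 hf
      simp only [LinearMap.mem_ker, LinearMap.comp_apply, Submodule.subtype_apply,
        AlgHom.toLinearMap_apply, Ideal.Quotient.mkₐ_eq_mk, Ideal.Quotient.eq_zero_iff_mem]
      exact ⟨fun h => Ideal.subset_span ⟨hf, h⟩, hker f hf⟩)
  have hφ' : ∀ (f : MvPolynomial (Fin n) ℂ) (w : Fin d → ℂ), f.totalDegree ≤ R → w = ev M v f →
      ∀ (hw : w ∈ ballSpace (fun i => (M i).mulVecLin) v R),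
      (φ ⟨w, hw⟩ : MvPolynomial (Fin n) ℂ ⧸ Ideal.span N) = Ideal.Quotient.mk _ f := by
    rintro f w hf rfl hw
    exact hφ ⟨f, (mem_restrictTotalDegree _ _ _).2 hf⟩ hw
  refine ⟨Ideal.span N, φ, ?_, ?_⟩
  · intro j hj i w hw hv' hvi
    rw [hballj j (by lia)] at hw
    obtain ⟨p, hp, rfl⟩ := hw
    have hp := (mem_restrictTotalDegree _ _ _).1 hp
    have hdX : (X i : MvPolynomial (Fin n) ℂ).totalDegree = 1 := totalDegree_X i
    have hX : ev M v (X i * p) = M i *ᵥ ev M v p := by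
      rw [ev_mul hcomm _ _ (by lia), X, PM_monomial]
      simp [wd]
    rw [hφ' (X i * p) _ ((totalDegree_mul _ _).trans (by lia)) (by rw [hX]; rfl),
      hφ' p _ (by lia) rfl, muX, LinearMap.mulLeft_apply, map_mul]
  · rintro _ ⟨f, hf, rfl⟩ hx
    have hf := (mem_restrictTotalDegree _ _ _).1 hf
    have hx : Ideal.Quotient.mk (Ideal.span N) f ∈ _ := hx
    obtain ⟨g, hg, hgf⟩ := (Ideal.mem_map_iff_of_surjective _ Ideal.Quotient.mk_surjective).1 hx
    have hfr : f ∈ (Ideal.span N).radical := by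
      have h1 := Ideal.le_radical (Ideal.Quotient.eq.1 hgf)
      have := Ideal.sub_mem _ hg h1
      simpa using this
    change Ideal.Quotient.mk (Ideal.span N) f = 0
    exact Ideal.Quotient.eq_zero_iff_mem.2 (Ideal.subset_span ⟨hf, hrad f hf hfr⟩)
end

section
/- Fix n ∈ ℕ₊ and let K : ℕ → ℕ be any function satisfying the conclusion of the effective Nullstellensatz in n variables (as in the statement of the effective Nullstellensatz: for all R, for polynomials of degree at most R, membership in the ideal, respectively in its radical, is witnessed by coefficient polynomials with deg(hᵢfᵢ) ≤ K(R), respectively deg(gᵢfᵢ) ≤ K(R) with Σgᵢfᵢ = f^m). Let R, d ∈ ℕ, let ℳ be a ∗-closed tuple of d×d complex matrices, let A ⊆ ℂ^d be a subspace, and assume ℳ is 2·K(2R)-commutative on A. Then there exist k ∈ ℕ and w₁, …, w_k ∈ A such that the R-ballspaces B_ℳ(wᵢ, R) are regular, pairwise orthogonal, and Σ_{i=1}^k dim B_ℳ(wᵢ, R) ≥ (1/eⁿ)·dim(A), where e is Euler's number. -/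
open MvPolynomial Module Matrix

variable {V : Type*} [AddCommGroup V] [Module ℂ V]

/-! ### Operators attached to lists of letters -/

noncomputable def lop {n : ℕ} (M : Fin n → Module.End ℂ V) (l : List (Fin n)) : Module.End ℂ V :=
  (l.map M).prod

theorem lop_append {n : ℕ} (M : Fin n → Module.End ℂ V) (l l' : List (Fin n)) :
    lop M (l ++ l') = lop M l * lop M l' := by
  simp [lop]

theorem mword_eq_lop {n : ℕ} (M : Fin n → Module.End ℂ V) {q : ℕ} (α : Fin q → Fin n) :
    mword M α = lop M (List.ofFn α) := by
  simp [mword, lop, List.map_ofFn, Function.comp_def]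

theorem lop_perm {n : ℕ} (M : Fin n → Module.End ℂ V) {r : ℕ} {v : V} (h : RCommAt M r v)
    {l l' : List (Fin n)} (hl : l.Perm l') (hr : l.length ≤ r) : lop M l v = lop M l' v := by
  have hlen : l'.length = l.length := hl.length_eq.symm
  obtain ⟨q, hq⟩ : ∃ q, q = l.length := ⟨_, rfl⟩
  obtain ⟨α, rfl⟩ : ∃ α : Fin q → Fin n, l = List.ofFn α := by
    subst hq; exact ⟨l.get, by simp⟩
  obtain ⟨β, rfl⟩ : ∃ β : Fin q → Fin n, l' = List.ofFn β := by
    rw [← hq] at hlen; subst hlen; exact ⟨l'.get, by simp⟩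
  have key : α ∘ Tuple.sort α = β ∘ Tuple.sort β := by
    refine List.ofFn_injective ?_
    exact ((((Tuple.sort α).ofFn_comp_perm α).trans hl).trans
      ((Tuple.sort β).ofFn_comp_perm β).symm).eq_of_pairwise'
      (Tuple.monotone_sort α).sortedLE_ofFn.pairwise (Tuple.monotone_sort β).sortedLE_ofFn.pairwise
  have hs : List.length (List.ofFn α) ≤ r := hr
  rw [List.length_ofFn] at hs
  have h1 := h q hs α (Tuple.sort α)
  have h2 := h q hs β (Tuple.sort β)
  rw [mword_eq_lop, mword_eq_lop] at h1 h2
  rw [h1, h2, key]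

/-- The span of operators of words of length at most `r`. -/
noncomputable def Dop {n : ℕ} (M : Fin n → Module.End ℂ V) (r : ℕ) :
    Submodule ℂ (Module.End ℂ V) :=
  Submodule.span ℂ {T | ∃ l : List (Fin n), l.length ≤ r ∧ T = lop M l}

theorem lop_mem_Dop {n : ℕ} (M : Fin n → Module.End ℂ V) {r : ℕ} {l : List (Fin n)}
    (h : l.length ≤ r) : lop M l ∈ Dop M r := Submodule.subset_span ⟨l, h, rfl⟩

theorem Dop_mono {n : ℕ} (M : Fin n → Module.End ℂ V) {r s : ℕ} (h : r ≤ s) :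
    Dop M r ≤ Dop M s :=
  Submodule.span_mono (by rintro T ⟨l, hl, rfl⟩; exact ⟨l, hl.trans h, rfl⟩)

theorem Dop_mul {n : ℕ} (M : Fin n → Module.End ℂ V) {r s : ℕ} {S T : Module.End ℂ V}
    (hS : S ∈ Dop M r) (hT : T ∈ Dop M s) : S * T ∈ Dop M (r + s) := by
  have := Submodule.mul_mem_mul hS hT
  refine (?_ : Dop M r * Dop M s ≤ Dop M (r + s)) this
  rw [Dop, Dop, Submodule.span_mul_span]
  refine Submodule.span_le.2 ?_
  rintro _ ⟨_, ⟨l, hl, rfl⟩, _, ⟨l', hl', rfl⟩, rfl⟩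
  simp only [← lop_append]
  exact lop_mem_Dop M (by simp; omega)

theorem one_mem_Dop {n : ℕ} (M : Fin n → Module.End ℂ V) (r : ℕ) : (1 : Module.End ℂ V) ∈ Dop M r := by
  have := lop_mem_Dop M (r := r) (l := []) (by simp)
  simpa [lop] using this

theorem Dop_pow {n : ℕ} (M : Fin n → Module.End ℂ V) {t : ℕ} {T : Module.End ℂ V}
    (hT : T ∈ Dop M t) (m : ℕ) : T ^ m ∈ Dop M (m * t) := by
  induction m with
  | zero => simpa using one_mem_Dop M 0
  | succ m ih => rw [pow_succ, Nat.succ_mul]; exact Dop_mul M ih hT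

theorem ballSpace_eq_map_s15 {n : ℕ} (M : Fin n → Module.End ℂ V) (w : V) (r : ℕ) :
    ballSpace M w r = (Dop M r).map (LinearMap.applyₗ w) := by
  rw [ballSpace, Dop, Submodule.map_span]
  congr 1
  ext v
  constructor
  · rintro ⟨q, hq, α, rfl⟩
    exact ⟨lop M (List.ofFn α), ⟨_, by simpa using hq, rfl⟩, by simp [mword_eq_lop]⟩
  · rintro ⟨_, ⟨l, hl, rfl⟩, rfl⟩
    exact ⟨l.length, hl, l.get, by simp [mword_eq_lop]⟩

theorem mem_ballSpace {n : ℕ} (M : Fin n → Module.End ℂ V) (w : V) (r : ℕ) (v : V) :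
    v ∈ ballSpace M w r ↔ ∃ T ∈ Dop M r, T w = v := by
  rw [ballSpace_eq_map_s15]; simp [Submodule.mem_map]

theorem Dop_comm {n : ℕ} (M : Fin n → Module.End ℂ V) {r a b : ℕ} {v : V} (h : RCommAt M r v)
    (hab : a + b ≤ r) {S T : Module.End ℂ V} (hS : S ∈ Dop M a) (hT : T ∈ Dop M b) :
    S (T v) = T (S v) := by
  induction hS using Submodule.span_induction with
  | zero => simp
  | add x y _ _ hx hy => simp [hx, hy]
  | smul c x _ hx => simp [hx]
  | mem x hx =>
    obtain ⟨l, hl, rfl⟩ := hx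
    induction hT using Submodule.span_induction with
    | zero => simp
    | add x y _ _ hx hy => simp [hx, hy]
    | smul c x _ hx => simp [hx]
    | mem x hx =>
      obtain ⟨l', hl', rfl⟩ := hx
      have := lop_perm M h (List.perm_append_comm (l₁ := l) (l₂ := l')) (by simp; omega)
      simpa [lop_append] using this

/-! ### Evaluation of polynomials -/

noncomputable def monop {n : ℕ} (M : Fin n → Module.End ℂ V) (a : Fin n →₀ ℕ) : Module.End ℂ V :=
  lop M (Finsupp.toMultiset a).toList

theorem length_monop {n : ℕ} (a : Fin n →₀ ℕ) : (Finsupp.toMultiset a).toList.length = a.degree := by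
  simp [Finsupp.degree_apply, Finsupp.card_toMultiset, Finsupp.sum]

theorem monop_mem {n : ℕ} (M : Fin n → Module.End ℂ V) {a : Fin n →₀ ℕ} {r : ℕ}
    (h : a.degree ≤ r) : monop M a ∈ Dop M r :=
  lop_mem_Dop M (by rwa [length_monop])

theorem lop_eq_monop {n : ℕ} (M : Fin n → Module.End ℂ V) {r : ℕ} {v : V} (h : RCommAt M r v)
    (l : List (Fin n)) (hl : l.length ≤ r) :
    lop M l v = monop M (Multiset.toFinsupp (l : Multiset (Fin n))) v := by
  refine lop_perm M h ?_ hl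
  rw [← Multiset.coe_eq_coe]; simp

theorem monop_add {n : ℕ} (M : Fin n → Module.End ℂ V) {r : ℕ} {v : V} (h : RCommAt M r v)
    (a b : Fin n →₀ ℕ) (hab : a.degree + b.degree ≤ r) :
    monop M (a + b) v = monop M a (monop M b v) := by
  rw [← Module.End.mul_apply, monop, monop, monop, ← lop_append]
  refine lop_perm M h ?_ ?_
  · rw [← Multiset.coe_eq_coe, ← Multiset.coe_add]; simp
  · rw [length_monop]; simpa using hab

theorem monop_zero {n : ℕ} (M : Fin n → Module.End ℂ V) : monop M 0 = 1 := by simp [monop, lop]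

theorem monop_single {n : ℕ} (M : Fin n → Module.End ℂ V) (i : Fin n) :
    monop M (Finsupp.single i 1) = M i := by simp [monop, lop]

noncomputable def evop {n : ℕ} (M : Fin n → Module.End ℂ V) :
    MvPolynomial (Fin n) ℂ →ₗ[ℂ] Module.End ℂ V :=
  (basisMonomials (Fin n) ℂ).constr ℂ (monop M)

theorem evop_monomial {n : ℕ} (M : Fin n → Module.End ℂ V) (a : Fin n →₀ ℕ) (c : ℂ) :
    evop M (monomial a c) = c • monop M a := by
  have : monomial a c = c • basisMonomials (Fin n) ℂ a := by simp [smul_monomial]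
  rw [this, map_smul, evop, Basis.constr_basis]

theorem evop_one {n : ℕ} (M : Fin n → Module.End ℂ V) : evop M 1 = 1 := by
  have := evop_monomial M 0 1
  simpa [monop_zero] using this

theorem evop_X {n : ℕ} (M : Fin n → Module.End ℂ V) (i : Fin n) : evop M (X i) = M i := by
  have := evop_monomial M (Finsupp.single i 1) 1
  simpa [monop_single, X] using this

theorem degree_le_of_mem {n : ℕ} {f : MvPolynomial (Fin n) ℂ} {a : Fin n →₀ ℕ}
    (h : a ∈ f.support) : a.degree ≤ f.totalDegree := by
  have := le_totalDegree h
  simpa [Finsupp.degree_apply, Finsupp.sum] using this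

theorem evop_eq_sum {n : ℕ} (M : Fin n → Module.End ℂ V) (f : MvPolynomial (Fin n) ℂ) :
    evop M f = ∑ a ∈ f.support, f.coeff a • monop M a := by
  conv_lhs => rw [f.as_sum]
  simp only [map_sum, evop_monomial]

theorem evop_mem {n : ℕ} (M : Fin n → Module.End ℂ V) {f : MvPolynomial (Fin n) ℂ} {r : ℕ}
    (h : f.totalDegree ≤ r) : evop M f ∈ Dop M r := by
  rw [evop_eq_sum]
  exact Submodule.sum_mem _ fun a ha => Submodule.smul_mem _ _
    (monop_mem M ((degree_le_of_mem ha).trans h))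

theorem evop_mul {n : ℕ} (M : Fin n → Module.End ℂ V) {r : ℕ} {v : V} (h : RCommAt M r v)
    (f g : MvPolynomial (Fin n) ℂ) (hfg : f.totalDegree + g.totalDegree ≤ r) :
    evop M (f * g) v = evop M f (evop M g v) := by
  have : f * g = ∑ a ∈ f.support, ∑ b ∈ g.support, monomial (a + b) (f.coeff a * g.coeff b) := by
    conv_lhs => rw [f.as_sum, g.as_sum]
    simp only [Finset.sum_mul_sum, monomial_mul]
  rw [this, evop_eq_sum M f, evop_eq_sum M g]
  simp only [map_sum, LinearMap.sum_apply, LinearMap.smul_apply, map_smul, evop_monomial,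
    Finset.smul_sum]
  rw [Finset.sum_comm]
  refine Finset.sum_congr rfl fun b hb => ?_
  refine Finset.sum_congr rfl fun a ha => ?_
  rw [monop_add M h, mul_comm, mul_smul]
  have := degree_le_of_mem ha
  have := degree_le_of_mem hb
  omega

theorem evop_pow {n : ℕ} (M : Fin n → Module.End ℂ V) {r : ℕ} {v : V} (h : RCommAt M r v)
    (f : MvPolynomial (Fin n) ℂ) (m : ℕ) (hm : m * f.totalDegree ≤ r) :
    evop M (f ^ m) v = (evop M f ^ m) v := by
  induction m with
  | zero => simp [evop_one]
  | succ m ih =>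
    rw [Nat.succ_mul] at hm
    rw [pow_succ', pow_succ', evop_mul M h, ih (by omega)]; · rfl
    have := totalDegree_pow f m
    omega

theorem mem_ballSpace_iff_evop {n : ℕ} (M : Fin n → Module.End ℂ V) {s r : ℕ} {w : V}
    (h : RCommAt M s w) (hr : r ≤ s) (v : V) :
    v ∈ ballSpace M w r ↔ ∃ f : MvPolynomial (Fin n) ℂ, f.totalDegree ≤ r ∧ evop M f w = v := by
  constructor
  · suffices ballSpace M w r ≤ (restrictTotalDegree (Fin n) ℂ r).map
        ((LinearMap.applyₗ w).comp (evop M)) by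
      intro hv
      obtain ⟨f, hf, rfl⟩ := this hv
      exact ⟨f, (mem_restrictTotalDegree _ _ _).1 hf, rfl⟩
    refine Submodule.span_le.2 ?_
    rintro _ ⟨q, hq, α, rfl⟩
    rw [mword_eq_lop, lop_eq_monop M h _ (by simp; omega)]
    refine ⟨monomial (Multiset.toFinsupp (List.ofFn α : Multiset (Fin n))) 1, ?_, ?_⟩
    · refine (mem_restrictTotalDegree _ _ _).2 ?_
      rw [totalDegree_monomial _ one_ne_zero]
      have := Finsupp.card_toMultiset (Multiset.toFinsupp (List.ofFn α : Multiset (Fin n)))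
      rw [Multiset.toFinsupp_toMultiset] at this
      simp only [Multiset.coe_card, List.length_ofFn] at this
      change (Finsupp.sum _ fun _ => id) ≤ r
      omega
    · simp [evop_monomial]
  · rintro ⟨f, hf, rfl⟩
    exact (mem_ballSpace M w r _).2 ⟨_, evop_mem M hf, rfl⟩

/-! ### Growth of ballspaces -/

/-- Standard exponents. -/
def stdExp {n : ℕ} (v : (Fin n →₀ ℕ) → V) : Set (Fin n →₀ ℕ) :=
  {a | v a ∉ Submodule.span ℂ (v '' {b | toDegLex b < toDegLex a})}

theorem stdExp_span {n : ℕ} (v : (Fin n →₀ ℕ) → V) (a : Fin n →₀ ℕ) :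
    v a ∈ Submodule.span ℂ (v '' {b | b ∈ stdExp v ∧ toDegLex b ≤ toDegLex a}) := by
  suffices H : ∀ x : DegLex (Fin n →₀ ℕ), v (ofDegLex x) ∈
      Submodule.span ℂ (v '' {b | b ∈ stdExp v ∧ toDegLex b ≤ x}) from H (toDegLex a)
  intro x
  induction x using (wellFounded_lt (α := DegLex (Fin n →₀ ℕ))).induction with
  | _ x ih =>
    by_cases hx : ofDegLex x ∈ stdExp v
    · exact Submodule.subset_span ⟨_, ⟨hx, le_rfl⟩, rfl⟩
    · have hx' : v (ofDegLex x) ∈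
        Submodule.span ℂ (v '' {b | toDegLex b < toDegLex (ofDegLex x)}) := not_not.1 hx
      refine (Submodule.span_le.2 ?_) hx'
      rintro _ ⟨b, hb, rfl⟩
      have hb' : toDegLex b < x := hb
      refine Submodule.span_mono ?_ (ih (toDegLex b) hb')
      rintro _ ⟨c, ⟨hc, hcb⟩, rfl⟩
      exact ⟨c, ⟨hc, hcb.trans hb'.le⟩, rfl⟩

theorem stdExp_indep {n : ℕ} (v : (Fin n →₀ ℕ) → V) :
    LinearIndependent ℂ (fun a : stdExp v => v a) := by
  classical
  rw [linearIndependent_iff']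
  intro s g hg
  by_contra! hne
  obtain ⟨i, hi, hgi⟩ := hne
  obtain ⟨a, ha, hmax⟩ := (s.filter fun i => g i ≠ 0).exists_max_image
    (fun i => toDegLex (i : Fin n →₀ ℕ)) ⟨i, by simp [hi, hgi]⟩
  rw [Finset.mem_filter] at ha
  refine a.2 ?_
  have hsum := Finset.add_sum_erase s (fun i => g i • v i) ha.1
  simp only [hg] at hsum
  have : v a = -(g a)⁻¹ • ∑ x ∈ s.erase a, g x • v x := by
    rw [eq_neg_of_add_eq_zero_right hsum, neg_smul, smul_neg, neg_neg, smul_smul,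
      inv_mul_cancel₀ ha.2, one_smul]
  rw [this]
  refine Submodule.smul_mem _ _ (Submodule.sum_mem _ fun x hx => ?_)
  rw [Finset.mem_erase] at hx
  by_cases hgx : g x = 0
  · simp [hgx]
  · refine Submodule.smul_mem _ _ (Submodule.subset_span ⟨x, ?_, rfl⟩)
    have := hmax x (by simp [hx.2, hgx])
    refine lt_of_le_of_ne this fun h => hx.1 (Subtype.ext h)

theorem degree_finite (n r : ℕ) : {a : Fin n →₀ ℕ | a.degree ≤ r}.Finite :=
  Finsupp.finite_of_degree_le r

theorem stdExp_lower {n : ℕ} (M : Fin n → Module.End ℂ V) {r : ℕ} {w : V} (h : RCommAt M r w)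
    {a c : Fin n →₀ ℕ} (hca : c ≤ a) (har : a.degree ≤ r)
    (ha : a ∈ stdExp (fun a => monop M a w)) : c ∈ stdExp (fun a => monop M a w) := by
  by_contra hc
  have hc' : monop M c w ∈ Submodule.span ℂ
    ((fun a => monop M a w) '' {b | toDegLex b < toDegLex c}) := not_not.1 hc
  obtain ⟨e, rfl⟩ := exists_add_of_le hca
  rw [map_add] at har
  refine ha ?_
  have h1 : monop M (c + e) w = monop M e (monop M c w) := by
    rw [add_comm, monop_add M h]; omega
  change monop M (c + e) w ∈ _
  rw [h1]
  have h2 := Submodule.mem_map_of_mem (f := monop M e) hc'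
  rw [Submodule.map_span] at h2
  refine Submodule.span_mono ?_ h2
  rintro _ ⟨_, ⟨b, hb, rfl⟩, rfl⟩
  have hb' : toDegLex b < toDegLex c := hb
  have hdeg : b.degree ≤ c.degree := Finsupp.DegLex.monotone_degree hb'.le
  refine ⟨b + e, ?_, ?_⟩
  · change toDegLex (b + e) < toDegLex (c + e)
    rw [toDegLex_add, toDegLex_add]
    exact add_lt_add_left hb' _
  · change monop M (b + e) w = _
    rw [add_comm, monop_add M h]; omega

theorem ball_growth {n : ℕ} [FiniteDimensional ℂ V] (M : Fin n → Module.End ℂ V) {s R : ℕ} {w : V}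
    (h : RCommAt M s w) (hs : 2 * R ≤ s) :
    finrank ℂ (ballSpace M w (2 * R)) ≤ 2 ^ n * finrank ℂ (ballSpace M w R) := by
  classical
  set v : (Fin n →₀ ℕ) → V := fun a => monop M a w with hv
  have hfin : ∀ r, (stdExp v ∩ {a | a.degree ≤ r}).Finite := fun r =>
    (degree_finite n r).subset Set.inter_subset_right
  let T : ℕ → Finset (Fin n →₀ ℕ) := fun r => (hfin r).toFinset
  have hT : ∀ r a, a ∈ T r ↔ a ∈ stdExp v ∧ a.degree ≤ r := by intro r a; simp [T]
  have h1 : finrank ℂ (ballSpace M w (2 * R)) ≤ (T (2 * R)).card := by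
    have hle : ballSpace M w (2 * R) ≤ Submodule.span ℂ (((T (2 * R)).image v : Finset V) : Set V) := by
      intro x hx
      obtain ⟨f, hf, rfl⟩ := (mem_ballSpace_iff_evop M h hs x).1 hx
      rw [evop_eq_sum, LinearMap.sum_apply]
      refine Submodule.sum_mem _ fun a ha => ?_
      rw [LinearMap.smul_apply]
      refine Submodule.smul_mem _ _ ?_
      refine Submodule.span_mono ?_ (stdExp_span v a)
      rintro _ ⟨b, ⟨hb, hba⟩, rfl⟩
      have hd : b.degree ≤ a.degree := Finsupp.DegLex.monotone_degree hba
      have := degree_le_of_mem ha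
      simp only [Finset.coe_image]
      exact ⟨b, (hT _ _).2 ⟨hb, by omega⟩, rfl⟩
    exact (Submodule.finrank_mono hle).trans
      ((finrank_span_finset_le_card _).trans Finset.card_image_le)
  have h2 : (T R).card ≤ finrank ℂ (ballSpace M w R) := by
    have hli : LinearIndependent ℂ (fun a : T R => v a) :=
      (stdExp_indep v).comp (fun a : T R => ⟨a, ((hT _ _).1 a.2).1⟩)
        (fun a b hab => Subtype.ext (by simpa using hab))
    have := finrank_span_eq_card hli
    rw [Fintype.card_coe] at this
    rw [← this]
    refine Submodule.finrank_mono (Submodule.span_le.2 ?_)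
    rintro _ ⟨a, rfl⟩
    exact (mem_ballSpace M w R _).2 ⟨_, monop_mem M ((hT _ _).1 a.2).2, rfl⟩
  have h3 : (T (2 * R)).card ≤ 2 ^ n * (T R).card := by
    let F : (Fin n →₀ ℕ) → (Fin n → Fin 2) × (Fin n →₀ ℕ) := fun a =>
      (fun i => ⟨a i % 2, Nat.mod_lt _ (by norm_num)⟩, a.mapRange (· / 2) (by simp))
    have : (T (2 * R)).card ≤ ((Finset.univ : Finset (Fin n → Fin 2)) ×ˢ T R).card := by
      refine Finset.card_le_card_of_injOn F ?_ ?_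
      · intro a ha
        have ha := (hT _ _).1 ha
        refine Finset.mem_coe.2 (Finset.mem_product.2 ⟨Finset.mem_univ _, (hT _ _).2 ⟨?_, ?_⟩⟩)
        · refine stdExp_lower M h (a := a) ?_ (ha.2.trans hs) ha.1
          intro i
          simpa [F] using Nat.div_le_self _ _
        · have h5 : 2 * (F a).2.degree ≤ a.degree := by
            rw [Finsupp.degree_eq_sum, Finsupp.degree_eq_sum, Finset.mul_sum]
            refine Finset.sum_le_sum fun i _ => ?_
            simpa [F] using Nat.mul_div_le _ _
          omega
      · intro a _ b _ hab
        ext i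
        have e1 := congrArg (fun x => (x.1 i : ℕ)) hab
        have e2 := congrArg (fun x => x.2 i) hab
        simp only [F, Finsupp.mapRange_apply] at e1 e2
        omega
    simpa [Finset.card_product] using this
  exact h1.trans (h3.trans (Nat.mul_le_mul_left _ h2))

/-! ### Adjoints and regularity -/

section Inner

variable {E : Type*} [NormedAddCommGroup E] [InnerProductSpace ℂ E] [FiniteDimensional ℂ E]

theorem adjoint_mem_Dop {n : ℕ} (M : Fin n → Module.End ℂ E)
    (hM : ∀ i, ∃ j, LinearMap.adjoint (M i) = M j) {r : ℕ} {T : Module.End ℂ E}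
    (hT : T ∈ Dop M r) : LinearMap.adjoint T ∈ Dop M r := by
  have key : ∀ l : List (Fin n), ∃ l' : List (Fin n), l'.length = l.length ∧
      LinearMap.adjoint (lop M l) = lop M l' := by
    intro l
    induction l with
    | nil =>
      refine ⟨[], rfl, ?_⟩
      have : lop M [] = LinearMap.id := by simp [lop]; rfl
      rw [this]
      exact LinearMap.adjoint_id
    | cons i l ih =>
      obtain ⟨l', hl', e⟩ := ih
      obtain ⟨j, hj⟩ := hM i
      refine ⟨l' ++ [j], by simp [hl'], ?_⟩
      have h1 : lop M (i :: l) = M i ∘ₗ lop M l := by simp [lop]; rfl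
      have h2 : lop M (l' ++ [j]) = lop M l' ∘ₗ M j := by simp [lop]; rfl
      rw [h1, h2, LinearMap.adjoint_comp, e, hj]
  induction hT using Submodule.span_induction with
  | zero => simp
  | add x y _ _ hx hy => rw [map_add]; exact add_mem hx hy
  | smul c x _ hx => rw [map_smulₛₗ]; exact Submodule.smul_mem _ _ hx
  | mem x hx =>
    obtain ⟨l, hl, rfl⟩ := hx
    obtain ⟨l', hl', e⟩ := key l
    rw [e]
    exact lop_mem_Dop M (by omega)

theorem nilp_zero {n : ℕ} (M : Fin n → Module.End ℂ E)
    (hM : ∀ i, ∃ j, LinearMap.adjoint (M i) = M j) {k t : ℕ} {w : E} (h : RCommAt M (2 * k) w)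
    {T : Module.End ℂ E} (hT : T ∈ Dop M t) (m : ℕ) (hm : (m + 1) * t ≤ k)
    (h0 : (T ^ (m + 1)) w = 0) : T w = 0 := by
  induction m with
  | zero => simpa using h0
  | succ m ih =>
    have hm' : (m + 1) * t ≤ k := le_trans (Nat.mul_le_mul_right _ (by omega)) hm
    refine ih hm' ?_
    set u := (T ^ (m + 1)) w with hu
    set S := LinearMap.adjoint T with hS
    have hSm : S ∈ Dop M t := adjoint_mem_Dop M hM hT
    have h1 : T (S u) = 0 := by
      have hb : (S * T ^ (m + 1)) ∈ Dop M (t + (m + 1) * t) := Dop_mul M hSm (Dop_pow M hT _)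
      have hc := Dop_comm M h (a := t) (b := t + (m + 1) * t) (by nlinarith) hT hb
      simp only [Module.End.mul_apply] at hc
      rw [hu, hc, ← Module.End.mul_apply (T ^ (m + 1)) T, ← pow_succ, h0, map_zero]
    have h2 : S u = 0 := by
      rw [← inner_self_eq_zero (𝕜 := ℂ)]
      conv_lhs => rw [hS, LinearMap.adjoint_inner_left, ← hS, h1, inner_zero_right]
    rw [← inner_self_eq_zero (𝕜 := ℂ)]
    have h3 : u = T ((T ^ m) w) := by rw [hu, pow_succ']; rfl
    have h4 : inner ℂ (T ((T ^ m) w)) u = inner ℂ ((T ^ m) w) (S u) := by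
      rw [hS, LinearMap.adjoint_inner_right]
    rw [← h3, h2, inner_zero_right] at h4
    exact h4

theorem effNull_ge {n : ℕ} (hn : 0 < n) {K : ℕ → ℕ} (hK : EffNullFunction n K) (R : ℕ) :
    R ≤ K R := by
  let x : MvPolynomial (Fin n) ℂ := X ⟨0, hn⟩ ^ R
  have hx : x.totalDegree = R := totalDegree_X_pow _ _
  obtain ⟨h, h1, h2⟩ := (hK R 1 x (fun _ => x) hx.le (fun _ => hx.le)).1
    (Ideal.subset_span ⟨0, rfl⟩)
  have := h2 0
  simp only [Finset.univ_unique, Finset.sum_singleton] at h1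
  have h3 : h 0 * x = x := h1
  rw [h3, hx] at this
  exact this

theorem evop_comb_zero {n k N : ℕ} (M : Fin n → Module.End ℂ V) {w : V} (h : RCommAt M N w)
    (F g : Fin k → MvPolynomial (Fin n) ℂ) (hF : ∀ i, evop M (F i) w = 0)
    (hg : ∀ i, (g i * F i).totalDegree ≤ N) : evop M (∑ i, g i * F i) w = 0 := by
  rw [map_sum, LinearMap.sum_apply]
  refine Finset.sum_eq_zero fun i _ => ?_
  by_cases h1 : g i = 0
  · simp [h1]
  by_cases h2 : F i = 0
  · simp [h2]
  rw [evop_mul M h, hF, map_zero]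
  rw [← totalDegree_mul_of_isDomain h1 h2]
  exact hg i

theorem totalDegree_pow_eq {n : ℕ} (f : MvPolynomial (Fin n) ℂ) (hf : f ≠ 0) (m : ℕ) :
    (f ^ m).totalDegree = m * f.totalDegree := by
  induction m with
  | zero => simp
  | succ m ih => rw [pow_succ, totalDegree_mul_of_isDomain (pow_ne_zero _ hf) hf, ih]; ring

/-- Two maps with the same kernel have isomorphic ranges. -/
theorem exists_equiv_of_ker {P A B : Type*} [AddCommGroup P] [Module ℂ P] [AddCommGroup A]
    [Module ℂ A] [AddCommGroup B] [Module ℂ B] (e : P →ₗ[ℂ] A) (p : P →ₗ[ℂ] B)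
    (hk : LinearMap.ker e = LinearMap.ker p) (SA : Submodule ℂ A) (SB : Submodule ℂ B)
    (hA : LinearMap.range e = SA) (hB : LinearMap.range p = SB) :
    ∃ φ : SA ≃ₗ[ℂ] SB, ∀ x (hx : e x ∈ SA), (φ ⟨e x, hx⟩ : B) = p x := by
  subst hA hB
  refine ⟨(e.quotKerEquivRange.symm.trans (Submodule.quotEquivOfEq _ _ hk)).trans
    p.quotKerEquivRange, fun x hx => ?_⟩
  simp only [LinearEquiv.trans_apply]
  have : e.quotKerEquivRange.symm ⟨e x, hx⟩ = (LinearMap.ker e).mkQ x := by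
    rw [LinearEquiv.symm_apply_eq]; rfl
  rw [this]; rfl

theorem ball_regular {n : ℕ} (hn : 0 < n) {K : ℕ → ℕ} (hK : EffNullFunction n K) (R : ℕ)
    (M : Fin n → Module.End ℂ E) (hM : ∀ i, ∃ j, LinearMap.adjoint (M i) = M j) {w : E}
    (h : RCommAt M (2 * K (2 * R)) w) : IsRegularBall M w R := by
  classical
  have hge := effNull_ge hn hK (2 * R)
  let Q : Set (MvPolynomial (Fin n) ℂ) := {f | f.totalDegree ≤ 2 * R ∧ evop M f w = 0}
  let 𝔞 : Ideal (MvPolynomial (Fin n) ℂ) := Ideal.span Q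
  obtain ⟨s, hsQ, hs⟩ : ∃ s : Finset (MvPolynomial (Fin n) ℂ), (s : Set _) ⊆ Q ∧
      Ideal.span Q = Ideal.span (s : Set (MvPolynomial (Fin n) ℂ)) :=
    (Submodule.fg_span_iff_fg_span_finset_subset Q).1 (IsNoetherian.noetherian _)
  let F : Fin s.card → MvPolynomial (Fin n) ℂ := fun i => s.equivFin.symm i
  have hFr : Set.range F = s := by
    ext x; constructor
    · rintro ⟨i, rfl⟩; exact (s.equivFin.symm i).2
    · intro hx; exact ⟨s.equivFin ⟨x, hx⟩, by simp [F]⟩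
  have hFQ : ∀ i, F i ∈ Q := fun i => hsQ (s.equivFin.symm i).2
  have h𝔞 : 𝔞 = Ideal.span (Set.range F) := by rw [hFr]; exact hs
  have hmem : ∀ f : MvPolynomial (Fin n) ℂ, f.totalDegree ≤ R → (f ∈ 𝔞 ↔ evop M f w = 0) := by
    intro f hf
    constructor
    · intro hfa
      rw [h𝔞] at hfa
      obtain ⟨g, rfl, hg⟩ := (hK (2 * R) _ f F (by omega) (fun i => (hFQ i).1)).1 hfa
      exact evop_comb_zero M h F g (fun i => (hFQ i).2) (fun i => (hg i).trans (by omega))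
    · intro hf0
      exact Ideal.subset_span ⟨by omega, hf0⟩
  let P := restrictTotalDegree (Fin n) ℂ R
  let e : P →ₗ[ℂ] E := ((LinearMap.applyₗ w).comp (evop M)).comp P.subtype
  let p : P →ₗ[ℂ] (MvPolynomial (Fin n) ℂ ⧸ 𝔞) :=
    (Ideal.Quotient.mkₐ ℂ 𝔞).toLinearMap.comp P.subtype
  have he : ∀ x : P, e x = evop M (x : MvPolynomial (Fin n) ℂ) w := fun x => rfl
  have hp : ∀ x : P, p x = Ideal.Quotient.mk 𝔞 (x : MvPolynomial (Fin n) ℂ) := fun x => rfl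
  have hk : LinearMap.ker e = LinearMap.ker p := by
    ext x
    rw [LinearMap.mem_ker, LinearMap.mem_ker, he, hp, Ideal.Quotient.eq_zero_iff_mem]
    exact (hmem _ ((mem_restrictTotalDegree _ _ _).1 x.2)).symm
  have hA : LinearMap.range e = ballSpace M w R := by
    ext v
    rw [mem_ballSpace_iff_evop M h (by omega)]
    constructor
    · rintro ⟨x, rfl⟩
      exact ⟨x, (mem_restrictTotalDegree _ _ _).1 x.2, rfl⟩
    · rintro ⟨f, hf, rfl⟩
      exact ⟨⟨f, (mem_restrictTotalDegree _ _ _).2 hf⟩, rfl⟩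
  have hB : LinearMap.range p = Fdeg n 𝔞 R := by
    rw [Fdeg, LinearMap.range_comp, Submodule.range_subtype]
  obtain ⟨φ, hφ⟩ := exists_equiv_of_ker e p hk _ _ hA hB
  refine ⟨𝔞, φ, ?_, ?_⟩
  · intro j hj i v hv hv' hvi
    obtain ⟨f, hf, rfl⟩ := (mem_ballSpace_iff_evop M h (by omega) v).1 hv
    have hXf : (X i * f).totalDegree ≤ R := by
      refine (totalDegree_mul _ _).trans ?_
      rw [totalDegree_X]; omega
    have e1 := hφ ⟨f, (mem_restrictTotalDegree _ _ _).2 (by omega)⟩ hv'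
    have hmul : evop M (X i * f) w = M i (evop M f w) := by
      rw [evop_mul M h, evop_X]
      rw [totalDegree_X]; omega
    have e2 := hφ ⟨X i * f, (mem_restrictTotalDegree _ _ _).2 hXf⟩ (by
      rw [he]; simp only [hmul]; exact hvi)
    simp only [he, hp, hmul] at e1 e2
    rw [e1, e2]
    simp [muX]
  · intro x hx hrad
    obtain ⟨f, hf, rfl⟩ := hx
    have hf : f.totalDegree ≤ R := (mem_restrictTotalDegree _ _ _).1 hf
    change Ideal.Quotient.mk 𝔞 f ∈ _ at hrad
    change Ideal.Quotient.mk 𝔞 f = 0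
    have hfr : f ∈ 𝔞.radical := by
      obtain ⟨g, hg, hgf⟩ :=
        (Ideal.mem_map_iff_of_surjective _ Ideal.Quotient.mk_surjective).1 hrad
      have := Ideal.le_radical ((Ideal.Quotient.eq).1 hgf)
      simpa using sub_mem hg this
    rw [Ideal.Quotient.eq_zero_iff_mem, hmem f hf]
    by_cases hf0 : f = 0
    · simp [hf0]
    rw [h𝔞] at hfr
    obtain ⟨m, g, hgm, hg⟩ := (hK (2 * R) _ f F (by omega) (fun i => (hFQ i).1)).2 hfr
    have hz : evop M (f ^ m) w = 0 := by
      rw [← hgm]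
      exact evop_comb_zero M h F g (fun i => (hFQ i).2) (fun i => (hg i).trans (by omega))
    have hdeg : m * f.totalDegree ≤ K (2 * R) := by
      rw [← totalDegree_pow_eq f hf0, ← hgm]
      exact totalDegree_finsetSum_le fun i _ => hg i
    rw [evop_pow M h f m (by omega)] at hz
    cases m with
    | zero =>
      have : w = 0 := by simpa using hz
      rw [this, map_zero]
    | succ m => exact nilp_zero M hM h (evop_mem M le_rfl) m hdeg hz

theorem ball_orth {n : ℕ} (M : Fin n → Module.End ℂ E)
    (hM : ∀ i, ∃ j, LinearMap.adjoint (M i) = M j) (R : ℕ) {w u : E}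
    (hu : u ∈ (ballSpace M w (2 * R))ᗮ) : ballSpace M u R ≤ (ballSpace M w R)ᗮ := by
  intro x hx
  rw [Submodule.mem_orthogonal]
  intro y hy
  obtain ⟨S, hS, rfl⟩ := (mem_ballSpace _ _ _ _).1 hx
  obtain ⟨T, hT, rfl⟩ := (mem_ballSpace _ _ _ _).1 hy
  rw [← LinearMap.adjoint_inner_left]
  refine (Submodule.mem_orthogonal _ _).1 hu _ ?_
  refine (mem_ballSpace _ _ _ _).2 ⟨LinearMap.adjoint S * T, ?_, rfl⟩
  rw [two_mul]
  exact Dop_mul M (adjoint_mem_Dop M hM hS) hT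

theorem greedy {n : ℕ} (M : Fin n → Module.End ℂ E)
    (hM : ∀ i, ∃ j, LinearMap.adjoint (M i) = M j) (R c : ℕ) (N : ℕ) :
    ∀ A : Submodule ℂ E, finrank ℂ A = N →
    (∀ w ∈ A, finrank ℂ (ballSpace M w (2 * R)) ≤ c * finrank ℂ (ballSpace M w R)) →
    ∃ (k : ℕ) (w : Fin k → E), (∀ i, w i ∈ A) ∧
      (∀ i j, i ≠ j → ballSpace M (w i) R ≤ (ballSpace M (w j) R)ᗮ) ∧
      finrank ℂ A ≤ c * ∑ i, finrank ℂ (ballSpace M (w i) R) := by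
  induction N using Nat.strong_induction_on with
  | _ N ih =>
    intro A hAN hgr
    by_cases hA : A = ⊥
    · subst hA
      exact ⟨0, Fin.elim0, fun i => i.elim0, fun i => i.elim0, by simp⟩
    obtain ⟨w, hw, hw0⟩ := A.exists_mem_ne_zero_of_ne_bot hA
    set B := ballSpace M w (2 * R) with hB
    have hwB : w ∈ B := (mem_ballSpace _ _ _ _).2 ⟨1, one_mem_Dop M _, rfl⟩
    have hlt : A ⊓ Bᗮ < A := by
      refine lt_of_le_of_ne inf_le_left fun heq => ?_
      have : w ∈ A ⊓ Bᗮ := by rw [heq]; exact hw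
      exact hw0 (inner_self_eq_zero (𝕜 := ℂ) |>.1 ((Submodule.mem_orthogonal _ _).1 this.2 w hwB))
    have hlt' := Submodule.finrank_lt_finrank_of_lt hlt
    obtain ⟨k, v, hvA, hvo, hvs⟩ := ih _ (hAN ▸ hlt') (A ⊓ Bᗮ) rfl
      (fun x hx => hgr x hx.1)
    have hdim : finrank ℂ A ≤ finrank ℂ (A ⊓ Bᗮ : Submodule ℂ E) + finrank ℂ B := by
      have h1 := Submodule.finrank_sup_add_finrank_inf_eq A Bᗮ
      have h2 := Submodule.finrank_add_finrank_orthogonal B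
      have h3 := Submodule.finrank_le (A ⊔ Bᗮ)
      omega
    have hvB : ∀ i, v i ∈ Bᗮ := fun i => (hvA i).2
    refine ⟨k + 1, Fin.cons w v, ?_, ?_, ?_⟩
    · intro i
      refine Fin.cases hw (fun i => (hvA i).1) i
    · intro i j
      refine Fin.cases ?_ (fun i => ?_) i <;> refine Fin.cases ?_ (fun j => ?_) j
      · intro h; exact absurd rfl h
      · intro _
        simp only [Fin.cons_zero, Fin.cons_succ]
        exact Submodule.le_orthogonal_iff_le_orthogonal.1 (ball_orth M hM R (hvB j))
      · intro _
        simp only [Fin.cons_zero, Fin.cons_succ]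
        exact ball_orth M hM R (hvB i)
      · intro h
        simp only [Fin.cons_succ]
        exact hvo i j (fun h' => h (by rw [h']))
    · have hs : ∑ i, finrank ℂ (ballSpace M ((Fin.cons w v : Fin (k + 1) → E) i) R) =
          finrank ℂ (ballSpace M w R) + ∑ i, finrank ℂ (ballSpace M (v i) R) := by
        rw [Fin.sum_univ_succ]; rfl
      rw [hs, mul_add]
      have := hgr w hw
      rw [← hB] at this
      omega

end Inner

/-- **Lemma (bootstrap).** Fix `n ∈ ℕ₊` and let `K` satisfy the conclusion of the effective
Nullstellensatz in `n` variables. Let `ℳ` be a `∗`-closed tuple of `d×d` complex matrices,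
`A ⊆ ℂ^d` a subspace on which `ℳ` is `2·K(2R)`-commutative. Then there exist `k ∈ ℕ` and
`w₁, …, w_k ∈ A` such that the `R`-ballspaces `B_ℳ(wᵢ, R)` are regular, pairwise orthogonal,
and `Σᵢ dim B_ℳ(wᵢ, R) ≥ (1/eⁿ)·dim A`. -/
theorem bootstrap_ballspaces
    (n : ℕ) (hn : 0 < n) (K : ℕ → ℕ) (hK : EffNullFunction n K)
    (R d : ℕ)
    (M : Fin n → Matrix (Fin d) (Fin d) ℂ)
    (hstar : ∀ i, ∃ j, (M i)ᴴ = M j)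
    (A : Submodule ℂ (EuclideanSpace ℂ (Fin d)))
    (hcomm : ∀ v ∈ A, RCommAt (fun i => Matrix.toEuclideanLin (M i)) (2 * K (2 * R)) v) :
    ∃ (k : ℕ) (w : Fin k → EuclideanSpace ℂ (Fin d)),
      (∀ i, w i ∈ A) ∧
      (∀ i, IsRegularBall (fun i' => Matrix.toEuclideanLin (M i')) (w i) R) ∧
      (∀ i j, i ≠ j →
        ballSpace (fun i' => Matrix.toEuclideanLin (M i')) (w i) R ≤
          (ballSpace (fun i' => Matrix.toEuclideanLin (M i')) (w j) R)ᗮ) ∧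
      (1 / Real.exp n) * (finrank ℂ A : ℝ) ≤
        ∑ i, (finrank ℂ (ballSpace (fun i' => Matrix.toEuclideanLin (M i')) (w i) R) : ℝ) := by


  have hM : ∀ i, ∃ j, LinearMap.adjoint (Matrix.toEuclideanLin (M i)) =
      Matrix.toEuclideanLin (M j) := by
    intro i
    obtain ⟨j, hj⟩ := hstar i
    exact ⟨j, by rw [← hj, Matrix.toEuclideanLin_conjTranspose_eq_adjoint]⟩
  have hge := effNull_ge hn hK (2 * R)
  obtain ⟨k, w, hwA, hwo, hws⟩ := greedy (fun i => Matrix.toEuclideanLin (M i)) hM R (2 ^ n)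
    _ A rfl (fun w hw => ball_growth _ (hcomm w hw) (by omega))
  refine ⟨k, w, hwA, fun i => ball_regular hn hK R _ hM (hcomm _ (hwA i)), hwo, ?_⟩
  have h1 : (finrank ℂ A : ℝ) ≤ 2 ^ n *
      ∑ i, (finrank ℂ (ballSpace (fun i' => Matrix.toEuclideanLin (M i')) (w i) R) : ℝ) := by
    exact_mod_cast hws
  have h2 : (2 : ℝ) ^ n ≤ Real.exp n := by
    rw [← Real.exp_one_pow]
    exact pow_le_pow_left₀ (by norm_num) (by linarith [Real.add_one_le_exp (1 : ℝ)]) n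
  rw [one_div, inv_mul_le_iff₀ (Real.exp_pos _)]
  refine h1.trans (mul_le_mul_of_nonneg_right h2 ?_)
  positivity
end
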